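/- arXiv:0807.0936 — 16 statements merged into one kernel-verified Lean document; each statement's English description precedes it below -/
import Mathlib

section
/- Let F be an algebraically closed field of characteristic 0 and let g be a nontrivial finite-dimensional semisimple Lie algebra over F. Then there is no bilinear product A : g × g → g satisfying, for all u, v, w ∈ g, both (PR1) A u v − A v u = ⁅u, v⁆ and (PR3) ⁅A u v, w⁆ + ⁅u, A w v⁆ = 0. Equivalently, a finite-dimensional Lie algebra over F carrying such a product A is not semisimple. -/
/-- In a Killing Lie algebra, a map `T` with `⁅T u, w⁆ + ⁅u, T w⁆ = 0` vanishes: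
the form `κ(⁅T u, w⁆, z)` is symmetric in `u, w` and alternating in `w, z`. -/
theorem LieAlgebra.IsKilling.eq_zero_of_lie_add_lie_eq_zero
    {F g : Type*} [Field F] [CharZero F] [LieRing g] [LieAlgebra F g] [FiniteDimensional F g]
    [LieAlgebra.IsKilling F g] {T : g → g} (hT : ∀ u w : g, ⁅T u, w⁆ + ⁅u, T w⁆ = 0) (u : g) :
    T u = 0 := by
  have symm (u w z : g) : killingForm F g ⁅T u, w⁆ z = killingForm F g ⁅T w, u⁆ z := by
    rw [eq_neg_of_add_eq_zero_left (hT u w), lie_skew]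
  have skew (u w z : g) : killingForm F g ⁅T u, w⁆ z = -killingForm F g ⁅T u, z⁆ w := by
    rw [LieModule.traceForm_apply_lie_apply, LieModule.traceForm_apply_lie_apply,
      ← lie_skew w z, map_neg]
  have vanish (u w z : g) : killingForm F g ⁅T u, w⁆ z = 0 := by
    have h : killingForm F g ⁅T u, w⁆ z = -killingForm F g ⁅T u, w⁆ z := by
      calc
        _ = -killingForm F g ⁅T u, z⁆ w := skew u w z
        _ = -killingForm F g ⁅T z, u⁆ w := by rw [symm]
        _ = killingForm F g ⁅T z, w⁆ u := by rw [skew, neg_neg]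
        _ = killingForm F g ⁅T w, z⁆ u := symm z w u
        _ = -killingForm F g ⁅T w, u⁆ z := skew w z u
        _ = -killingForm F g ⁅T u, w⁆ z := by rw [symm]
    exact self_eq_neg.mp h
  have hc : T u ∈ LieAlgebra.center F g := by
    rw [LieModule.mem_maxTrivSubmodule]
    intro w
    rw [← lie_skew, neg_eq_zero]
    exact (LieAlgebra.IsKilling.killingForm_nondegenerate F g).1 _ (vanish u w)
  rwa [LieAlgebra.center_eq_bot, LieSubmodule.mem_bot] at hc

/-- A nontrivial finite-dimensional semisimple Lie algebra over an algebraically closed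
field of characteristic 0 admits no bilinear product `A` satisfying (PR1) and (PR3). -/
theorem semisimple_no_PR_product
    {F : Type*} [Field F] [IsAlgClosed F] [CharZero F]
    {g : Type*} [LieRing g] [LieAlgebra F g] [FiniteDimensional F g]
    [Nontrivial g] [LieAlgebra.IsSemisimple F g] :
    ¬ ∃ A : g →ₗ[F] g →ₗ[F] g,
        (∀ u v : g, A u v - A v u = ⁅u, v⁆) ∧
        (∀ u v w : g, ⁅A u v, w⁆ + ⁅u, A w v⁆ = 0) := by
  rintro ⟨A, h1, h3⟩
  have hA (u v : g) : A u v = 0 :=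
    LieAlgebra.IsKilling.eq_zero_of_lie_add_lie_eq_zero (F := F) (T := fun x => A x v)
      (fun u w => h3 u v w) u
  have hab (u v : g) : ⁅u, v⁆ = 0 := by
    rw [← h1, hA, hA, sub_zero]
  obtain ⟨x, hx⟩ := exists_ne (0 : g)
  have hc : x ∈ LieAlgebra.center F g :=
    (LieModule.mem_maxTrivSubmodule F g g x).mpr fun w => hab w x
  rw [LieAlgebra.center_eq_bot, LieSubmodule.mem_bot] at hc
  exact hx hc
end

section
/- Let V be a vector space over a field F equipped with a bilinear product (u, v) ↦ u·v satisfying, for all u, v, w ∈ V, the identity (PR3'): (u·v)·w − w·(u·v) + u·(w·v) − (w·v)·u = 0. Then the commutator bracket [u, v] := u·v − v·u satisfies the Jacobi identity [[u, v], w] + [[v, w], u] + [[w, u], v] = 0 for all u, v, w ∈ V; that is, (V, [·,·]) is a Lie algebra (the product is Lie-admissible). -/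
/-- If a bilinear product on a vector space satisfies (PR3'):
`(u·v)·w − w·(u·v) + u·(w·v) − (w·v)·u = 0`, then the commutator bracket
`[u,v] = u·v − v·u` satisfies the Jacobi identity; i.e. the product is Lie-admissible. -/
theorem PR3'_implies_lie_admissible
    {F : Type*} [Field F]
    {V : Type*} [AddCommGroup V] [Module F V]
    (m : V →ₗ[F] V →ₗ[F] V)
    (PR3' : ∀ u v w : V, m (m u v) w - m w (m u v) + m u (m w v) - m (m w v) u = 0) :
    ∀ u v w : V,
      (m (m u v - m v u) w - m w (m u v - m v u)) +
        (m (m v w - m w v) u - m u (m v w - m w v)) +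
        (m (m w u - m u w) v - m v (m w u - m u w)) = 0 := by
  intro u v w
  simp only [map_sub, LinearMap.sub_apply]
  have h := congrArg₂ (· + ·) (congrArg₂ (· + ·) (PR3' u v w) (PR3' v w u)) (PR3' w u v)
  simp only [add_zero] at h
  rw [← h]
  abel
end

section
/- Let (g, B, A) be a pseudo-Riemannian Lie algebra over a field F of characteristic 0, and let C(g) = {a ∈ g : A a x = A x a for all x ∈ g} (equivalently, by (PR1), the center of the Lie algebra g). Then C(g) is invariant under left and right multiplication, i.e., for all a ∈ C(g) and x ∈ g one has A a x ∈ C(g) and A x a ∈ C(g); moreover A x y = 0 for all x, y ∈ C(g). -/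
/-- In a pseudo-Riemannian Lie algebra, the center `C(g) = {a | ∀ x, A a x = A x a}`
is invariant under left and right multiplication, and the product of any two central
elements vanishes. -/
theorem center_is_ideal_and_null
    {F : Type*} [Field F] [CharZero F]
    {g : Type*} [LieRing g] [LieAlgebra F g]
    (B : g →ₗ[F] g →ₗ[F] F)
    (hsymm : ∀ u v : g, B u v = B v u)
    (hnd : ∀ u : g, (∀ v : g, B u v = 0) → u = 0)
    (A : g →ₗ[F] g →ₗ[F] g)
    (PR1 : ∀ u v : g, A u v - A v u = ⁅u, v⁆)
    (PR2 : ∀ u v w : g, B (A u v) w + B v (A u w) = 0)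
    (PR3 : ∀ u v w : g, ⁅A u v, w⁆ + ⁅u, A w v⁆ = 0) :
    (∀ a ∈ {a : g | ∀ x : g, A a x = A x a}, ∀ x : g,
        A a x ∈ {a : g | ∀ x : g, A a x = A x a} ∧
        A x a ∈ {a : g | ∀ x : g, A a x = A x a}) ∧
    (∀ x ∈ {a : g | ∀ x : g, A a x = A x a},
      ∀ y ∈ {a : g | ∀ x : g, A a x = A x a}, A x y = 0) := by
  have lie_eq_zero {a : g} (ha : ∀ x : g, A a x = A x a) (x : g) : ⁅a, x⁆ = 0 := by
    rw [← PR1, ha, sub_self]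
  have left_mem {a : g} (ha : ∀ x : g, A a x = A x a) (x z : g) :
      A (A a x) z = A z (A a x) := by
    have h := PR3 a x z
    rwa [lie_eq_zero ha, add_zero, ← PR1, sub_eq_zero] at h
  refine ⟨fun a ha x => ⟨left_mem ha x, ?_⟩, fun x hx y hy => hnd _ fun z => ?_⟩
  · rw [← ha x]
    exact left_mem ha x
  · have h₁ := PR2 x y z
    have h₂ := PR2 z y x
    have h₃ := PR2 y z x
    rw [hx z] at h₁
    rw [← hy z] at h₂
    rw [hy x, hsymm z] at h₃
    have h : (2 : F) * B (A x y) z = 0 := by linear_combination h₁ - h₂ + h₃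
    exact (mul_eq_zero.mp h).resolve_left two_ne_zero
end

section
/- Let (g, B, A) be a finite-dimensional pseudo-Riemannian Lie algebra over a field F of characteristic 0, let C(g) be its center, and let C(g)^⊥ = {u ∈ g : B(u, c) = 0 for all c ∈ C(g)}. Then C(g)^⊥ is invariant under left and right multiplication: for all y ∈ C(g)^⊥ and z ∈ g, A y z ∈ C(g)^⊥ and A z y ∈ C(g)^⊥. Moreover, if the restriction of B to C(g) is nondegenerate, then ⁅g, g⁆ ⊆ C(g)^⊥ and g = C(g) ⊕ C(g)^⊥ as a direct sum of subspaces. -/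
/-- In a finite-dimensional pseudo-Riemannian Lie algebra, the orthogonal complement
of the center is invariant under left and right multiplication; moreover if the
restriction of the form to the center is nondegenerate, then the derived algebra lies
in `C(g)^⊥` and `g = C(g) ⊕ C(g)^⊥`. -/
theorem center_orthogonal_ideal_and_decomposition
    {F : Type*} [Field F] [CharZero F]
    {g : Type*} [LieRing g] [LieAlgebra F g] [FiniteDimensional F g]
    (B : LinearMap.BilinForm F g)
    (hsymm : ∀ u v : g, B u v = B v u)
    (hnd : ∀ u : g, (∀ v : g, B u v = 0) → u = 0)
    (A : g →ₗ[F] g →ₗ[F] g)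
    (PR1 : ∀ u v : g, A u v - A v u = ⁅u, v⁆)
    (PR2 : ∀ u v w : g, B (A u v) w + B v (A u w) = 0)
    (PR3 : ∀ u v w : g, ⁅A u v, w⁆ + ⁅u, A w v⁆ = 0) :
    (∀ y ∈ B.orthogonal (LieAlgebra.center F g : Submodule F g), ∀ z : g,
        A y z ∈ B.orthogonal (LieAlgebra.center F g : Submodule F g) ∧
        A z y ∈ B.orthogonal (LieAlgebra.center F g : Submodule F g)) ∧
    ((∀ c ∈ (LieAlgebra.center F g : Submodule F g),
        (∀ c' ∈ (LieAlgebra.center F g : Submodule F g), B c c' = 0) → c = 0) →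
      (∀ u v : g, ⁅u, v⁆ ∈ B.orthogonal (LieAlgebra.center F g : Submodule F g)) ∧
        IsCompl (LieAlgebra.center F g : Submodule F g)
          (B.orthogonal (LieAlgebra.center F g : Submodule F g))) := by
  have hmem : ∀ x : g, x ∈ (LieAlgebra.center F g : Submodule F g) ↔ ∀ y : g, ⁅y, x⁆ = 0 :=
    fun x => LieModule.mem_maxTrivSubmodule F g g x
  have horth : ∀ x : g, x ∈ B.orthogonal (LieAlgebra.center F g : Submodule F g) ↔
      ∀ c ∈ (LieAlgebra.center F g : Submodule F g), B c x = 0 := fun x => Iff.rfl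
  have hcomm : ∀ c ∈ (LieAlgebra.center F g : Submodule F g), ∀ v : g, A v c = A c v := by
    intro c hc v
    rw [← sub_eq_zero, PR1, (hmem c).1 hc v]
  have hideal : ∀ c ∈ (LieAlgebra.center F g : Submodule F g), ∀ v : g,
      A c v ∈ (LieAlgebra.center F g : Submodule F g) := by
    intro c hc v
    refine (hmem _).2 fun w => ?_
    have h := PR3 c v w
    rw [← lie_skew c, (hmem c).1 hc, neg_zero, add_zero] at h
    rw [← lie_skew, h, neg_zero]
  refine ⟨fun y hy z => ⟨(horth _).2 fun c hc => ?_, (horth _).2 fun c hc => ?_⟩, fun hC => ?_⟩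
  · have h₁ := PR2 y c z
    have h₂ := PR2 c y z
    rw [hcomm c hc] at h₁
    have h₃ := (horth y).1 hy _ (hideal c hc y)
    have h₄ := (horth y).1 hy _ (hideal c hc z)
    rw [hsymm] at h₄
    linear_combination h₁ - h₂ + h₄
  · have h := PR2 z c y
    rw [hcomm c hc, (horth y).1 hy _ (hideal c hc z), zero_add] at h
    exact h
  · have hcc : ∀ c ∈ (LieAlgebra.center F g : Submodule F g),
        ∀ d ∈ (LieAlgebra.center F g : Submodule F g), A c d = 0 := by
      intro c hc d hd
      refine hC _ (hideal c hc d) fun e he => ?_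
      have h₁ := PR2 c d e
      have h₂ := PR2 e c d
      have h₃ := PR2 d e c
      rw [hsymm d] at h₁
      rw [hcomm c hc e, hsymm c] at h₂
      rw [hcomm e he d, hcomm c hc d, hsymm e] at h₃
      have : (2 : F) * B (A c d) e = 0 := by linear_combination h₁ - h₂ + h₃
      simpa using this
    have hzero : ∀ c ∈ (LieAlgebra.center F g : Submodule F g), ∀ v : g, A c v = 0 := by
      intro c hc v
      refine hC _ (hideal c hc v) fun d hd => ?_
      simpa [hcc c hc d hd] using PR2 c v d
    refine ⟨fun u v => (horth _).2 fun c hc => ?_, ?_⟩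
    · have h₁ := PR2 u c v
      have h₂ := PR2 v c u
      rw [hcomm c hc, hzero c hc, map_zero, LinearMap.zero_apply, zero_add] at h₁ h₂
      rw [← PR1, map_sub, h₁, h₂, sub_zero]
    · have hrefl : B.IsRefl := fun x y h => by rw [hsymm, h]
      refine (LinearMap.BilinForm.isCompl_orthogonal_iff_disjoint hrefl).2 ?_
      rw [Submodule.disjoint_def]
      exact fun x hx hx' => hC x hx fun c hc => by rw [hsymm, (horth x).1 hx' c hc]
end

section
/- Let (g, B, A) be a pseudo-Riemannian Lie algebra over a field F of characteristic 0. Then the orthogonal complement of the derived subalgebra ⁅g, g⁆ with respect to B equals the set of elements whose right multiplication is self-adjoint: ⁅g, g⁆^⊥ = {u ∈ g : B(A v u, w) = B(v, A w u) for all v, w ∈ g}. -/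
/-- In a pseudo-Riemannian Lie algebra, the orthogonal complement of the derived
subalgebra `⁅g,g⁆` equals the set of elements `u` whose right multiplication
`r_u : v ↦ A v u` is self-adjoint with respect to `B`. -/
theorem orthogonal_derived_eq_selfadjoint_right_mult
    {F : Type*} [Field F] [CharZero F]
    {g : Type*} [LieRing g] [LieAlgebra F g]
    (B : LinearMap.BilinForm F g)
    (hsymm : ∀ u v : g, B u v = B v u)
    (hnd : ∀ u : g, (∀ v : g, B u v = 0) → u = 0)
    (A : g →ₗ[F] g →ₗ[F] g)
    (PR1 : ∀ u v : g, A u v - A v u = ⁅u, v⁆)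
    (PR2 : ∀ u v w : g, B (A u v) w + B v (A u w) = 0)
    (PR3 : ∀ u v w : g, ⁅A u v, w⁆ + ⁅u, A w v⁆ = 0) :
    ∀ u : g,
      u ∈ B.orthogonal (Submodule.span F {z : g | ∃ v w : g, ⁅v, w⁆ = z}) ↔
        ∀ v w : g, B (A v u) w = B v (A w u) := by
  intro u
  have key : ∀ v w : g, B ⁅v, w⁆ u = B v (A w u) - B (A v u) w := by
    intro v w
    rw [← PR1 v w, map_sub, LinearMap.sub_apply]
    linear_combination PR2 v w u - PR2 w v u + hsymm (A v u) w
  rw [LinearMap.BilinForm.mem_orthogonal_iff]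
  constructor
  · intro h v w
    have hvw : B ⁅v, w⁆ u = 0 := h _ (Submodule.subset_span ⟨v, w, rfl⟩)
    rw [key, sub_eq_zero] at hvw
    exact hvw.symm
  · intro h z hz
    induction hz using Submodule.span_induction with
    | mem z hz =>
      obtain ⟨v, w, rfl⟩ := hz
      rw [key, h v w, sub_self]
    | zero => simp
    | add x y _ _ hx hy => simp [hx, hy]
    | smul c x _ hx => simp [hx]
end

section
/- Let (g, B, A) be a finite-dimensional Riemann-Lie algebra (a real pseudo-Riemannian Lie algebra whose bilinear form B is positive definite). Then the orthogonal complement of the derived subalgebra equals the right annihilator: ⁅g, g⁆^⊥ = Z_r(g), where Z_r(g) = {u ∈ g : A v u = 0 for all v ∈ g}. -/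
/-- In a finite-dimensional Riemann-Lie algebra (real, positive definite form), the
orthogonal complement of the derived subalgebra equals the right annihilator
`Z_r(g) = {u | ∀ v, A v u = 0}`. -/
theorem riemann_orthogonal_derived_eq_right_annihilator
    {g : Type*} [LieRing g] [LieAlgebra ℝ g] [FiniteDimensional ℝ g]
    (B : LinearMap.BilinForm ℝ g)
    (hsymm : ∀ u v : g, B u v = B v u)
    (hpos : ∀ u : g, u ≠ 0 → 0 < B u u)
    (A : g →ₗ[ℝ] g →ₗ[ℝ] g)
    (PR1 : ∀ u v : g, A u v - A v u = ⁅u, v⁆)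
    (PR2 : ∀ u v w : g, B (A u v) w + B v (A u w) = 0)
    (PR3 : ∀ u v w : g, ⁅A u v, w⁆ + ⁅u, A w v⁆ = 0) :
    ∀ u : g,
      u ∈ B.orthogonal (Submodule.span ℝ {z : g | ∃ v w : g, ⁅v, w⁆ = z}) ↔
        ∀ v : g, A v u = 0 := by
  have eq_zero_of_self : ∀ x : g, B x x = 0 → x = 0 := fun x hx => by
    by_contra h
    exact (hpos x h).ne' hx
  intro u
  rw [LinearMap.BilinForm.mem_orthogonal_iff]
  constructor
  · intro hu
    -- `v ↦ A v u` is symmetric, kills `u`, and squares to zero.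
    have symm_right : ∀ v w : g, B (A v u) w = B v (A w u) := fun v w => by
      have h : B ⁅v, w⁆ u = 0 := hu _ (Submodule.subset_span ⟨v, w, rfl⟩)
      rw [← PR1, map_sub, LinearMap.sub_apply] at h
      linarith [PR2 v w u, PR2 w v u, hsymm w (A v u)]
    have self_eq_zero : A u u = 0 := eq_zero_of_self _ <| by
      rw [symm_right]
      linarith [PR2 (A u u) u u, hsymm u (A (A u u) u)]
    have comm_left : ∀ v : g, A (A v u) u = A u (A v u) := fun v => by
      have h := PR3 v u u
      rw [self_eq_zero, lie_zero, add_zero, ← PR1] at h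
      exact sub_eq_zero.mp h
    have sq_form : ∀ v w : g, B (A (A v u) u) (A w u) = 0 := fun v w => by
      have h := PR2 u (A v u) (A w u)
      rw [← comm_left, ← comm_left] at h
      linarith [symm_right (A v u) (A w u)]
    have sq_eq_zero : ∀ v : g, A (A v u) u = 0 := fun v =>
      eq_zero_of_self _ (sq_form v (A v u))
    intro v
    apply eq_zero_of_self
    rw [symm_right, sq_eq_zero, map_zero]
  · intro hu z hz
    change B z u = 0
    induction hz using Submodule.span_induction with
    | mem z hz =>
      obtain ⟨v, w, rfl⟩ := hz
      have hv := PR2 v w u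
      have hw := PR2 w v u
      rw [hu, map_zero, add_zero] at hv hw
      rw [← PR1, map_sub, LinearMap.sub_apply, hv, hw, sub_zero]
    | zero => simp
    | add x y _ _ hx hy => simp [hx, hy]
    | smul c x _ hx => simp [hx]
end

section
/- Let (g, B, A) be a finite-dimensional Riemann-Lie algebra (a real pseudo-Riemannian Lie algebra whose bilinear form B is positive definite). Then the linear span of {A x y : x, y ∈ g} equals the derived subalgebra ⁅g, g⁆. -/
/-- In a Riemann-Lie algebra, every vector `z` orthogonal to all brackets is parallel. -/
theorem riemann_product_eq_zero_of_orthogonal_bracket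
    {g : Type*} [LieRing g] [LieAlgebra ℝ g]
    (B : LinearMap.BilinForm ℝ g)
    (hsymm : ∀ u v : g, B u v = B v u)
    (hpos : ∀ u : g, u ≠ 0 → 0 < B u u)
    (A : g →ₗ[ℝ] g →ₗ[ℝ] g)
    (PR1 : ∀ u v : g, A u v - A v u = ⁅u, v⁆)
    (PR2 : ∀ u v w : g, B (A u v) w + B v (A u w) = 0)
    (PR3 : ∀ u v w : g, ⁅A u v, w⁆ + ⁅u, A w v⁆ = 0)
    (z : g) (hz : ∀ x y : g, B ⁅x, y⁆ z = 0) (x : g) : A x z = 0 := by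
  have eq_zero (u : g) (hu : B u u = 0) : u = 0 := by
    by_contra h
    exact (hpos u h).ne' hu
  have symm_right (u w : g) : B (A u z) w = B u (A w z) := by
    have h : B (A u w) z - B (A w u) z = 0 := by
      rw [← LinearMap.sub_apply, ← map_sub, PR1, hz]
    linarith [PR2 u z w, PR2 w z u, hsymm (A u w) z, hsymm (A w u) z, hsymm u (A w z)]
  have self_zero : A z z = 0 := by
    apply eq_zero
    rw [symm_right]
    linarith [PR2 (A z z) z z, hsymm (A (A z z) z) z]
  have comm (w : g) : A z (A w z) = A (A w z) z := by
    have h := PR3 z z w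
    rwa [self_zero, zero_lie, zero_add, ← PR1, sub_eq_zero] at h
  have sq_zero : A (A x z) z = 0 := by
    apply eq_zero
    have h := PR2 z (A x z) (A (A x z) z)
    rw [comm, comm, ← symm_right (A x z)] at h
    linarith
  apply eq_zero
  rw [symm_right, sq_zero, map_zero]

/-- In a finite-dimensional Riemann-Lie algebra (real, positive definite form), the
span of all products `A x y` equals the derived subalgebra `⁅g,g⁆`. -/
theorem riemann_product_span_eq_derived
    {g : Type*} [LieRing g] [LieAlgebra ℝ g] [FiniteDimensional ℝ g]
    (B : LinearMap.BilinForm ℝ g)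
    (hsymm : ∀ u v : g, B u v = B v u)
    (hpos : ∀ u : g, u ≠ 0 → 0 < B u u)
    (A : g →ₗ[ℝ] g →ₗ[ℝ] g)
    (PR1 : ∀ u v : g, A u v - A v u = ⁅u, v⁆)
    (PR2 : ∀ u v w : g, B (A u v) w + B v (A u w) = 0)
    (PR3 : ∀ u v w : g, ⁅A u v, w⁆ + ⁅u, A w v⁆ = 0) :
    Submodule.span ℝ {z : g | ∃ x y : g, A x y = z} =
      Submodule.span ℝ {z : g | ∃ x y : g, ⁅x, y⁆ = z} := by
  have refl : B.IsRefl := fun u v h => by rw [hsymm, h]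
  have nondeg : B.Nondegenerate := by
    refine (LinearMap.IsRefl.nondegenerate_iff_separatingLeft refl).mpr ?_
    intro u hu
    by_contra h
    exact (hpos u h).ne' (hu u)
  apply le_antisymm
  · rw [Submodule.span_le]
    rintro _ ⟨x, y, rfl⟩
    rw [SetLike.mem_coe,
      ← LinearMap.BilinForm.orthogonal_orthogonal nondeg refl
        (Submodule.span ℝ {z : g | ∃ x y : g, ⁅x, y⁆ = z}),
      LinearMap.BilinForm.mem_orthogonal_iff]
    intro z hz
    rw [LinearMap.BilinForm.mem_orthogonal_iff] at hz
    have h := PR2 x z y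
    rwa [riemann_product_eq_zero_of_orthogonal_bracket B hsymm hpos A PR1 PR2 PR3 z
      (fun u v => hz _ (Submodule.subset_span ⟨u, v, rfl⟩)) x, map_zero,
      LinearMap.zero_apply, zero_add] at h
  · rw [Submodule.span_le]
    rintro _ ⟨x, y, rfl⟩
    rw [← PR1]
    exact sub_mem (Submodule.subset_span ⟨x, y, rfl⟩) (Submodule.subset_span ⟨y, x, rfl⟩)
end

section
/- Let (g, B, A) be a finite-dimensional Riemann-Lie algebra (a real pseudo-Riemannian Lie algebra whose bilinear form B is positive definite). Then g decomposes as an orthogonal direct sum g = Z_r(g) ⊕ ⁅g, g⁆, where Z_r(g) = {u ∈ g : A v u = 0 for all v ∈ g} is an abelian Lie subalgebra of g and the derived subalgebra ⁅g, g⁆ is an abelian Lie ideal of g. -/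
/-- The right annihilator `Z_r(g) = {u | ∀ v, A v u = 0}` as a submodule. -/
def rightAnnihilator {g : Type*} [AddCommGroup g] [Module ℝ g]
    (A : g →ₗ[ℝ] g →ₗ[ℝ] g) : Submodule ℝ g where
  carrier := {u | ∀ v : g, A v u = 0}
  add_mem' := by intro a b ha hb v; rw [map_add, ha v, hb v, add_zero]
  zero_mem' := by intro v; exact map_zero (A v)
  smul_mem' := by intro c a ha v; rw [map_smul, ha v, smul_zero]

section PseudoRiemannian

variable {g : Type*} [LieRing g] [LieAlgebra ℝ g] {B : LinearMap.BilinForm ℝ g}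
  {A : g →ₗ[ℝ] g →ₗ[ℝ] g}

/-- If `x ↦ A x s` is self-adjoint, then it vanishes. -/
theorem right_mul_eq_zero_of_selfAdjoint
    (hsymm : ∀ u v : g, B u v = B v u) (hdef : ∀ u : g, B u u = 0 → u = 0)
    (PR1 : ∀ u v : g, A u v - A v u = ⁅u, v⁆)
    (PR2 : ∀ u v w : g, B (A u v) w + B v (A u w) = 0)
    (PR3 : ∀ u v w : g, ⁅A u v, w⁆ + ⁅u, A w v⁆ = 0)
    {s : g} (hs : ∀ x y : g, B (A x s) y = B x (A y s)) (u : g) : A u s = 0 := by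
  have hss : A s s = 0 := by
    apply hdef
    linarith [hs s (A s s), PR2 (A s s) s s, hsymm s (A (A s s) s)]
  have hcomm (x : g) : A (A x s) s = A s (A x s) := by
    have h := PR3 x s s
    rwa [hss, lie_zero, add_zero, ← PR1, sub_eq_zero] at h
  have hTT (x y : g) : B (A (A x s) s) (A y s) = 0 := by
    have h1 := PR2 s (A x s) (A y s)
    rw [← hcomm, ← hcomm] at h1
    linarith [hs (A x s) (A y s)]
  have hT : A (A u s) s = 0 := hdef _ (hTT u (A u s))
  apply hdef
  rw [← hs, hT]
  simp

theorem right_mul_sq_selfAdjoint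
    (hsymm : ∀ u v : g, B u v = B v u)
    (PR1 : ∀ u v : g, A u v - A v u = ⁅u, v⁆)
    (PR2 : ∀ u v w : g, B (A u v) w + B v (A u w) = 0)
    (PR3 : ∀ u v w : g, ⁅A u v, w⁆ + ⁅u, A w v⁆ = 0) (u v w : g) :
    B (A (A u v) v) w = B u (A (A w v) v) := by
  have h := congrArg (fun z => B z v) (PR3 u v w)
  simp only [← PR1, map_add, map_sub, LinearMap.add_apply, LinearMap.sub_apply, map_zero,
    LinearMap.zero_apply] at h
  linarith [PR2 (A u v) w v, PR2 w (A u v) v, PR2 u (A w v) v, PR2 (A w v) u v,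
    hsymm (A u v) (A w v), hsymm w (A (A u v) v)]

theorem right_mul_sq_eq_zero
    (hsymm : ∀ u v : g, B u v = B v u) (hdef : ∀ u : g, B u u = 0 → u = 0)
    (PR1 : ∀ u v : g, A u v - A v u = ⁅u, v⁆)
    (PR2 : ∀ u v w : g, B (A u v) w + B v (A u w) = 0)
    (PR3 : ∀ u v w : g, ⁅A u v, w⁆ + ⁅u, A w v⁆ = 0) (u v : g) :
    A (A u v) v = 0 := by
  have hT (x y : g) : B (A (A x v) v) y = B x (A (A y v) v) :=
    right_mul_sq_selfAdjoint hsymm PR1 PR2 PR3 x v y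
  have hv : A (A v v) v = 0 := by
    apply hdef
    rw [← hT]
    linarith [PR2 (A (A (A v v) v) v) v v, hsymm v (A (A (A (A v v) v) v) v),
      hT (A (A v v) v) v, hsymm (A (A (A (A v v) v) v) v) v]
  have hcomm (x f : g) (hf : A (A f v) v = 0) : A (A (A x v) v) f = A f (A (A x v) v) := by
    rw [← sub_eq_zero, PR1, eq_neg_of_add_eq_zero_left (PR3 (A x v) v f),
      eq_neg_of_add_eq_zero_left (PR3 x v (A f v)), hf]
    simp
  have hcube (x : g) : A (A (A x v) v) v = 0 := by
    have h1 := hcomm x v hv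
    have h2 := hcomm (A x v) v hv
    have h3 := hcomm x (A v v) (by rw [hv]; simp)
    generalize A (A x v) v = e at h1 h2 h3 ⊢
    have h4 := congrArg (fun z => B z v) (PR3 e e v)
    simp only [← PR1, map_add, map_sub, LinearMap.add_apply, LinearMap.sub_apply, map_zero,
      LinearMap.zero_apply] at h4
    rw [← h1] at h4
    have h5 := PR2 (A e e) v v
    have h6 := PR2 v (A e e) v
    have h7 := PR2 e e (A v v)
    have h8 := PR2 (A v v) e e
    have h9 := PR2 e (A e v) v
    have h10 := PR2 (A e v) e v
    have h11 := PR2 v e (A e v)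
    rw [h3] at h7
    rw [h2] at h10
    rw [← h1] at h11
    apply hdef
    linarith [hsymm (A (A e e) v) v, hsymm (A (A v v) e) e]
  apply hdef
  rw [hT, hcube]
  simp

theorem mul_mul_swap
    (hsymm : ∀ u v : g, B u v = B v u) (hdef : ∀ u : g, B u u = 0 → u = 0)
    (PR1 : ∀ u v : g, A u v - A v u = ⁅u, v⁆)
    (PR2 : ∀ u v w : g, B (A u v) w + B v (A u w) = 0)
    (PR3 : ∀ u v w : g, ⁅A u v, w⁆ + ⁅u, A w v⁆ = 0) (u v w : g) :
    A (A u v) w = -A (A u w) v := by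
  have h0 := right_mul_sq_eq_zero hsymm hdef PR1 PR2 PR3 u
  have h := h0 (v + w)
  simp only [map_add, LinearMap.add_apply, h0, zero_add, add_zero] at h
  rw [add_comm] at h
  exact eq_neg_of_add_eq_zero_left h

theorem mul_mul_eq_zero
    (hsymm : ∀ u v : g, B u v = B v u) (hdef : ∀ u : g, B u u = 0 → u = 0)
    (PR1 : ∀ u v : g, A u v - A v u = ⁅u, v⁆)
    (PR2 : ∀ u v w : g, B (A u v) w + B v (A u w) = 0)
    (PR3 : ∀ u v w : g, ⁅A u v, w⁆ + ⁅u, A w v⁆ = 0) (u v z : g) :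
    A (A u v) z = 0 := by
  have hsq := right_mul_sq_eq_zero hsymm hdef PR1 PR2 PR3
  have hswap := mul_mul_swap hsymm hdef PR1 PR2 PR3
  have hleft : A (A u v) (A (A u v) z) = -A (A (A u v) (A u v)) z := by
    have h := PR3 u v (A u z)
    simp only [← PR1] at h
    have h' := congrArg (fun y => A y v) h
    simp only [map_add, map_sub, LinearMap.add_apply, LinearMap.sub_apply, map_zero,
      LinearMap.zero_apply] at h'
    rw [hswap u v (A u z), hswap (A u z) v u, map_neg, map_neg, LinearMap.neg_apply,
      LinearMap.neg_apply, hsq, hsq, neg_zero, zero_sub, sub_zero] at h'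
    calc A (A u v) (A (A u v) z) = A (A u (A (A u z) v)) v := by
          rw [hswap u v z, map_neg, hswap u v (A (A u z) v), neg_neg]
      _ = A (A (A u z) (A u v)) v := by rw [← sub_eq_zero, ← h']; abel
      _ = A (A (A u v) z) (A u v) := by
          rw [hswap (A u z) (A u v) v, hswap u z v]; simp
      _ = _ := hswap _ _ _
  apply hdef
  have h1 := PR2 (A u v) z (A (A u v) z)
  have h2 := PR2 (A (A u v) (A u v)) z z
  rw [hleft, map_neg] at h1
  linarith [hsymm z (A (A (A u v) (A u v)) z)]

end PseudoRiemannian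

/-- A finite-dimensional Riemann-Lie algebra decomposes as the orthogonal direct sum
`g = Z_r(g) ⊕ ⁅g,g⁆`, where `Z_r(g)` is an abelian subalgebra and `⁅g,g⁆` is an abelian
ideal. -/
theorem riemann_orthogonal_decomposition
    {g : Type*} [LieRing g] [LieAlgebra ℝ g] [FiniteDimensional ℝ g]
    (B : LinearMap.BilinForm ℝ g)
    (hsymm : ∀ u v : g, B u v = B v u)
    (hpos : ∀ u : g, u ≠ 0 → 0 < B u u)
    (A : g →ₗ[ℝ] g →ₗ[ℝ] g)
    (PR1 : ∀ u v : g, A u v - A v u = ⁅u, v⁆)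
    (PR2 : ∀ u v w : g, B (A u v) w + B v (A u w) = 0)
    (PR3 : ∀ u v w : g, ⁅A u v, w⁆ + ⁅u, A w v⁆ = 0) :
    IsCompl (rightAnnihilator A) (Submodule.span ℝ {z : g | ∃ x y : g, ⁅x, y⁆ = z}) ∧
    (∀ s ∈ rightAnnihilator A, ∀ t ∈ Submodule.span ℝ {z : g | ∃ x y : g, ⁅x, y⁆ = z},
        B s t = 0) ∧
    (∀ s ∈ rightAnnihilator A, ∀ s' ∈ rightAnnihilator A, ⁅s, s'⁆ = 0) ∧
    (∀ t ∈ Submodule.span ℝ {z : g | ∃ x y : g, ⁅x, y⁆ = z},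
      ∀ t' ∈ Submodule.span ℝ {z : g | ∃ x y : g, ⁅x, y⁆ = z}, ⁅t, t'⁆ = 0) ∧
    (∀ x : g, ∀ t ∈ Submodule.span ℝ {z : g | ∃ x y : g, ⁅x, y⁆ = z},
        ⁅x, t⁆ ∈ Submodule.span ℝ {z : g | ∃ x y : g, ⁅x, y⁆ = z}) := by
  have hdef (u : g) (hu : B u u = 0) : u = 0 := by
    by_contra h
    exact (hpos u h).ne' hu
  have horth : ∀ s ∈ rightAnnihilator A,
      ∀ t ∈ Submodule.span ℝ {z : g | ∃ x y : g, ⁅x, y⁆ = z}, B s t = 0 := by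
    intro s hs t ht
    induction ht using Submodule.span_induction with
    | mem z hz =>
      obtain ⟨x, y, rfl⟩ := hz
      have h1 := PR2 x s y
      have h2 := PR2 y s x
      rw [hs x, map_zero, LinearMap.zero_apply, zero_add] at h1
      rw [hs y, map_zero, LinearMap.zero_apply, zero_add] at h2
      rw [← PR1, map_sub, h1, h2, sub_zero]
    | zero => simp
    | add x y _ _ hx hy => rw [map_add, hx, hy, add_zero]
    | smul c x _ hx => rw [map_smul, hx, smul_zero]
  have hann : rightAnnihilator A =
      B.orthogonal (Submodule.span ℝ {z : g | ∃ x y : g, ⁅x, y⁆ = z}) := by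
    ext s
    constructor
    · intro hs t ht
      exact (hsymm t s).trans (horth s hs t ht)
    · intro hs u
      refine right_mul_eq_zero_of_selfAdjoint hsymm hdef PR1 PR2 PR3 (fun x y => ?_) u
      have h : B ⁅x, y⁆ s = 0 := hs _ (Submodule.subset_span ⟨x, y, rfl⟩)
      rw [← PR1, map_sub, LinearMap.sub_apply] at h
      linarith [PR2 x y s, PR2 y x s, hsymm (A x s) y]
  have hleft : ∀ t ∈ Submodule.span ℝ {z : g | ∃ x y : g, ⁅x, y⁆ = z}, A t = 0 := by
    intro t ht
    refine (Submodule.span_le (p := LinearMap.ker A)).2 ?_ ht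
    rintro _ ⟨x, y, rfl⟩
    ext w
    simp [← PR1, mul_mul_eq_zero hsymm hdef PR1 PR2 PR3]
  refine ⟨?_, horth, ?_, ?_, fun x t _ => Submodule.subset_span ⟨x, t, rfl⟩⟩
  · have hB : B.IsRefl := fun x y h => (hsymm y x).trans h
    rw [hann]
    refine ((LinearMap.BilinForm.isCompl_orthogonal_iff_disjoint hB).2 ?_).symm
    rw [Submodule.disjoint_def]
    exact fun x hx hx' => hdef x (hx' x hx)
  · intro s hs s' hs'
    rw [← PR1, hs s', hs' s, sub_zero]
  · intro t ht t' ht'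
    rw [← PR1, hleft t ht, hleft t' ht']
    simp
end

section
/- Let g be a finite-dimensional real Lie algebra and B a positive definite symmetric bilinear form (scalar product) on g. Let S = {s ∈ g : B(⁅s, u⁆, v) + B(u, ⁅s, v⁆) = 0 for all u, v ∈ g} (the set of elements whose adjoint action is skew-symmetric with respect to B). Then the following are equivalent: (1) there exists a bilinear product A : g × g → g making (g, B, A) a pseudo-Riemannian Lie algebra (i.e., satisfying (PR1), (PR2), (PR3)); (2) S is an abelian Lie subalgebra of g, the orthogonal complement U = S^⊥ is an abelian Lie ideal of g, and g = S ⊕ U as an orthogonal direct sum. -/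
/-- The set `S` of elements whose adjoint action is skew-symmetric with respect to `B`,
as a submodule. -/
def adSkewSymmPart {g : Type*} [LieRing g] [LieAlgebra ℝ g]
    (B : LinearMap.BilinForm ℝ g) : Submodule ℝ g where
  carrier := {s | ∀ u v : g, B ⁅s, u⁆ v + B u ⁅s, v⁆ = 0}
  add_mem' := by
    intro a b ha hb u v
    have h1 := ha u v
    have h2 := hb u v
    simp only [add_lie, map_add, LinearMap.add_apply] at *
    linarith
  zero_mem' := by intro u v; simp
  smul_mem' := by
    intro c a ha u v
    have h := ha u v
    simp only [smul_lie, map_smul, LinearMap.smul_apply, smul_eq_mul]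
    rw [← mul_add, h, mul_zero]

open LinearMap (BilinForm)

section BilinForm

variable {V : Type*} [AddCommGroup V] [Module ℝ V] {B : BilinForm ℝ V}

/-- A finite-dimensional Euclidean space has an orthonormal frame. -/
lemma exists_orthonormal_frame [FiniteDimensional ℝ V]
    (hsymm : ∀ u v : V, B u v = B v u) (hpos : ∀ u : V, u ≠ 0 → 0 < B u u) :
    ∃ (n : ℕ) (e : Fin n → V), ∀ x : V, x = ∑ i, B (e i) x • e i := by
  obtain ⟨v, hv⟩ := BilinForm.exists_orthogonal_basis (B := B) ⟨fun u v => by simpa using hsymm u v⟩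
  refine ⟨_, fun i => (√(B (v i) (v i)))⁻¹ • v i, fun x => ?_⟩
  conv_lhs => rw [← v.sum_repr x]
  refine Finset.sum_congr rfl fun i _ => ?_
  have hi : 0 < B (v i) (v i) := hpos _ (v.ne_zero i)
  have hB : B (v i) x = v.repr x i * B (v i) (v i) := by
    conv_lhs => rw [← v.sum_repr x]
    rw [map_sum, Finset.sum_eq_single i]
    · simp
    · intro j _ hj
      have : B (v i) (v j) = 0 := hv hj.symm
      simp [this]
    · simp
  have hs : √(B (v i) (v i)) * √(B (v i) (v i)) = B (v i) (v i) := Real.mul_self_sqrt hi.le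
  have hs0 : √(B (v i) (v i)) ≠ 0 := (Real.sqrt_pos.2 hi).ne'
  simp only [map_smul, LinearMap.smul_apply, smul_eq_mul, smul_smul, hB]
  congr 1
  field_simp
  rw [sq, hs]

lemma isCompl_orthogonal_of_pos [FiniteDimensional ℝ V]
    (hsymm : ∀ u v : V, B u v = B v u) (hpos : ∀ u : V, u ≠ 0 → 0 < B u u)
    (W : Submodule ℝ V) : IsCompl W (B.orthogonal W) := by
  rw [BilinForm.isCompl_orthogonal_iff_disjoint fun u v h => by rw [hsymm, h],
    Submodule.disjoint_def]
  intro x hx hx'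
  by_contra h
  exact (hpos x h).ne' (hx' x hx)

lemma sum_frame_skew {ι : Type*} [Fintype ι] {e : ι → V}
    (hsymm : ∀ u v : V, B u v = B v u) (he : ∀ x : V, x = ∑ i, B (e i) x • e i)
    {L : V →ₗ[ℝ] V} (hL : ∀ u v, B (L u) v + B u (L v) = 0) (f h : V →ₗ[ℝ] ℝ) :
    ∑ i, f (e i) * h (L (e i)) + ∑ i, f (L (e i)) * h (e i) = 0 := by
  have expand : ∀ (k : V →ₗ[ℝ] ℝ) (x : V), k x = ∑ j, B (e j) x * k (e j) := fun k x => by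
    conv_lhs => rw [he x]
    simp
  have h₁ : ∑ i, f (e i) * h (L (e i)) =
      ∑ i, ∑ j, B (e j) (L (e i)) * (f (e i) * h (e j)) := by
    refine Finset.sum_congr rfl fun i _ => ?_
    rw [expand h (L (e i)), Finset.mul_sum]
    exact Finset.sum_congr rfl fun j _ => by ring
  have h₂ : ∑ i, f (L (e i)) * h (e i) =
      ∑ i, ∑ j, B (e i) (L (e j)) * (f (e i) * h (e j)) := by
    rw [Finset.sum_comm]
    refine Finset.sum_congr rfl fun i _ => ?_
    rw [expand f (L (e i)), Finset.sum_mul]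
    exact Finset.sum_congr rfl fun j _ => by ring
  rw [h₁, h₂, ← Finset.sum_add_distrib]
  refine Finset.sum_eq_zero fun i _ => ?_
  rw [← Finset.sum_add_distrib]
  refine Finset.sum_eq_zero fun j _ => ?_
  have := hL (e i) (e j)
  rw [← add_mul, hsymm (e j), this, zero_mul]

end BilinForm

section PseudoRiemannian

variable {g : Type*} [LieRing g] [LieAlgebra ℝ g] {B : BilinForm ℝ g}

/-- The orthogonal complement of the derived algebra. -/
def derivedOrthogonal (B : BilinForm ℝ g) : Submodule ℝ g where
  carrier := {x | ∀ u v : g, B ⁅u, v⁆ x = 0}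
  add_mem' := by
    intro a b ha hb u v
    rw [map_add, ha u v, hb u v, add_zero]
  zero_mem' := by intro u v; simp
  smul_mem' := by
    intro c a ha u v
    rw [map_smul, ha u v, smul_zero]

/-- The map `b ∘ bᵗ`, where `b` is the bracket `g ⊗ g → g` and the transpose is taken with
respect to the scalar product for which the frame `e` is orthonormal. -/
def bracketGram {ι : Type*} [Fintype ι] (B : BilinForm ℝ g) (e : ι → g) : g →ₗ[ℝ] g :=
  ∑ i, ∑ j, (B ⁅e i, e j⁆).smulRight ⁅e i, e j⁆

lemma bracketGram_apply {ι : Type*} [Fintype ι] (e : ι → g) (x : g) :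
    bracketGram B e x = ∑ i, ∑ j, B ⁅e i, e j⁆ x • ⁅e i, e j⁆ := by
  simp [bracketGram]

lemma apply_bracketGram {ι : Type*} [Fintype ι] (e : ι → g) (f : g →ₗ[ℝ] ℝ) (x : g) :
    f (bracketGram B e x) = ∑ i, ∑ j, B ⁅e i, e j⁆ x * f ⁅e i, e j⁆ := by
  simp [bracketGram_apply]

lemma bracketGram_mem_orthogonal {ι : Type*} [Fintype ι] (hsymm : ∀ u v : g, B u v = B v u)
    (e : ι → g) (x : g) : bracketGram B e x ∈ B.orthogonal (derivedOrthogonal B) := by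
  intro n hn
  change B n _ = 0
  rw [apply_bracketGram]
  refine Finset.sum_eq_zero fun i _ => Finset.sum_eq_zero fun j _ => ?_
  rw [hsymm n, hn, mul_zero]

lemma mem_derivedOrthogonal_of_bracketGram {ι : Type*} [Fintype ι] {e : ι → g}
    (he : ∀ x : g, x = ∑ i, B (e i) x • e i) {x : g} (hx : B x (bracketGram B e x) = 0)
    (hsymm : ∀ u v : g, B u v = B v u) : x ∈ derivedOrthogonal B := by
  have hij : ∀ i j, B ⁅e i, e j⁆ x = 0 := by
    intro i j
    rw [apply_bracketGram] at hx
    simp only [hsymm x] at hx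
    rw [Finset.sum_eq_zero_iff_of_nonneg
      fun i _ => Finset.sum_nonneg fun j _ => mul_self_nonneg _] at hx
    have := hx i (Finset.mem_univ i)
    rw [Finset.sum_eq_zero_iff_of_nonneg fun j _ => mul_self_nonneg _] at this
    exact mul_self_eq_zero.1 (this j (Finset.mem_univ j))
  intro u v
  rw [he u, he v]
  simp [hij, sum_lie, lie_sum]

lemma bracketGram_eq_zero {ι : Type*} [Fintype ι] (e : ι → g) {x : g}
    (hx : x ∈ derivedOrthogonal B) : bracketGram B e x = 0 := by
  rw [bracketGram_apply]
  exact Finset.sum_eq_zero fun i _ => Finset.sum_eq_zero fun j _ => by rw [hx, zero_smul]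

/-- Every element of the derived algebra is in the range of `bracketGram`. -/
lemma exists_bracketGram_eq [FiniteDimensional ℝ g] {ι : Type*} [Fintype ι] {e : ι → g}
    (hsymm : ∀ u v : g, B u v = B v u) (hpos : ∀ u : g, u ≠ 0 → 0 < B u u)
    (he : ∀ x : g, x = ∑ i, B (e i) x • e i) {d : g}
    (hd : d ∈ B.orthogonal (derivedOrthogonal B)) : ∃ p, bracketGram B e p = d := by
  have hc := isCompl_orthogonal_of_pos hsymm hpos (LinearMap.range (bracketGram B e))
  obtain ⟨y, ⟨p, rfl⟩, n, hn, rfl⟩ :=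
    Submodule.mem_sup.1 (hc.sup_eq_top ▸ Submodule.mem_top (x := d))
  have hn' : n ∈ derivedOrthogonal B :=
    mem_derivedOrthogonal_of_bracketGram he ((hsymm _ _).trans (hn _ ⟨n, rfl⟩)) hsymm
  have hnd : n ∈ B.orthogonal (derivedOrthogonal B) := by
    simpa using Submodule.sub_mem _ hd (bracketGram_mem_orthogonal hsymm e p)
  refine ⟨p, ?_⟩
  by_cases h : n = 0
  · simp [h]
  · exact absurd (hnd n hn') (hpos n h).ne'

variable {A : g →ₗ[ℝ] g →ₗ[ℝ] g}

lemma lie_lie_eq_of_product (h1 : ∀ u v : g, A u v - A v u = ⁅u, v⁆)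
    (h3 : ∀ u v w : g, ⁅A u v, w⁆ + ⁅u, A w v⁆ = 0) (v u w : g) :
    ⁅v, ⁅u, w⁆⁆ = ⁅A v u, w⁆ + ⁅u, A v w⁆ := by
  have hu : A v u = ⁅v, u⁆ + A u v := by rw [← h1]; abel
  have hw : A v w = ⁅v, w⁆ + A w v := by rw [← h1]; abel
  rw [hu, hw, add_lie, lie_add, leibniz_lie, ← add_zero (⁅⁅v, u⁆, w⁆ + ⁅u, ⁅v, w⁆⁆), ← h3 u v w]
  abel

lemma lie_bracketGram_skew {ι : Type*} [Fintype ι] {e : ι → g}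
    (hsymm : ∀ u v : g, B u v = B v u) (he : ∀ x : g, x = ∑ i, B (e i) x • e i)
    (h1 : ∀ u v : g, A u v - A v u = ⁅u, v⁆)
    (h2 : ∀ u v w : g, B (A u v) w + B v (A u w) = 0)
    (h3 : ∀ u v w : g, ⁅A u v, w⁆ + ⁅u, A w v⁆ = 0) (v x y : g) :
    B y ⁅v, bracketGram B e x⁆ + B x ⁅v, bracketGram B e y⁆ = 0 := by
  let β : g → g →ₗ[ℝ] g →ₗ[ℝ] ℝ := fun x =>
    ((LieModule.toEnd ℝ g g : g →ₗ[ℝ] g →ₗ[ℝ] g)).compr₂ (B x)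
  have hβ : ∀ x u w, β x u w = B x ⁅u, w⁆ := fun x u w => rfl
  have key : ∀ x y, B y ⁅v, bracketGram B e x⁆ =
      ∑ j, ∑ i, β x (e i) (e j) * β y (A v (e i)) (e j) +
      ∑ i, ∑ j, β x (e i) (e j) * β y (e i) (A v (e j)) := by
    intro x y
    have := apply_bracketGram (B := B) e ((B y) ∘ₗ (LieModule.toEnd ℝ g g v)) x
    simp only [LinearMap.comp_apply, LieModule.toEnd_apply_apply] at this
    rw [this, Finset.sum_comm (f := fun j i => β x (e i) (e j) * β y (A v (e i)) (e j)),
      ← Finset.sum_add_distrib]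
    refine Finset.sum_congr rfl fun i _ => ?_
    rw [← Finset.sum_add_distrib]
    refine Finset.sum_congr rfl fun j _ => ?_
    rw [lie_lie_eq_of_product h1 h3, map_add, hsymm _ x, mul_add]
    rfl
  have h₁ : ∑ j, ∑ i, β x (e i) (e j) * β y (A v (e i)) (e j) +
      ∑ j, ∑ i, β y (e i) (e j) * β x (A v (e i)) (e j) = 0 := by
    rw [← Finset.sum_add_distrib]
    refine Finset.sum_eq_zero fun j _ => ?_
    rw [← sum_frame_skew hsymm he (h2 v) ((β x).flip (e j)) ((β y).flip (e j))]
    simp only [LinearMap.flip_apply]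
    congr 1
    exact Finset.sum_congr rfl fun i _ => mul_comm _ _
  have h₂ : ∑ i, ∑ j, β x (e i) (e j) * β y (e i) (A v (e j)) +
      ∑ i, ∑ j, β y (e i) (e j) * β x (e i) (A v (e j)) = 0 := by
    rw [← Finset.sum_add_distrib]
    refine Finset.sum_eq_zero fun i _ => ?_
    rw [← sum_frame_skew hsymm he (h2 v) (β x (e i)) (β y (e i))]
    congr 1
    exact Finset.sum_congr rfl fun j _ => mul_comm _ _
  rw [key x y, key y x]
  linarith

/-- The derived algebra of a Riemannian Lie algebra is abelian. -/
lemma lie_eq_zero_of_mem_orthogonal [FiniteDimensional ℝ g]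
    (hsymm : ∀ u v : g, B u v = B v u) (hpos : ∀ u : g, u ≠ 0 → 0 < B u u)
    (h1 : ∀ u v : g, A u v - A v u = ⁅u, v⁆)
    (h2 : ∀ u v w : g, B (A u v) w + B v (A u w) = 0)
    (h3 : ∀ u v w : g, ⁅A u v, w⁆ + ⁅u, A w v⁆ = 0) {u w : g}
    (hu : u ∈ B.orthogonal (derivedOrthogonal B)) (hw : w ∈ B.orthogonal (derivedOrthogonal B)) :
    ⁅u, w⁆ = 0 := by
  obtain ⟨n, e, he⟩ := exists_orthonormal_frame hsymm hpos
  have hskew := lie_bracketGram_skew hsymm he h1 h2 h3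
  have heq : ∀ z : g, (∀ r, B r z = 0) → z = 0 := fun z hz => by
    by_contra h
    exact (hpos z h).ne' (hz z)
  have hA : ∀ p q v, ⁅A (bracketGram B e p) v, bracketGram B e q⁆ = 0 := by
    intro p q v
    set K := bracketGram B e
    have anti : ∀ p q r, B r ⁅A (K p) v, K q⁆ = -B q ⁅A (K p) v, K r⁆ := fun p q r => by
      linarith [hskew (A (K p) v) q r]
    have sym : ∀ p q r, B r ⁅A (K p) v, K q⁆ = B r ⁅A (K q) v, K p⁆ := fun p q r => by
      rw [eq_neg_of_add_eq_zero_left (h3 (K p) v (K q)), lie_skew]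
    refine heq _ fun r => ?_
    linarith [anti p q r, sym p r q, anti r p q, sym r q p, anti q r p, sym q p r]
  obtain ⟨p, rfl⟩ := exists_bracketGram_eq hsymm hpos he hu
  obtain ⟨q, rfl⟩ := exists_bracketGram_eq hsymm hpos he hw
  have hmem : ⁅bracketGram B e p, bracketGram B e q⁆ ∈ B.orthogonal (derivedOrthogonal B) :=
    fun n hn => (hsymm _ _).trans (hn _ _)
  obtain ⟨t, ht⟩ := exists_bracketGram_eq hsymm hpos he hmem
  have hz : ⁅bracketGram B e p, bracketGram B e t⁆ = 0 := by
    rw [ht, ← lie_skew, ← h1 (bracketGram B e p), sub_lie, hA, hA, sub_zero, neg_zero]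
  have h := hskew (bracketGram B e p) q t
  rw [hz, map_zero, add_zero, ← ht] at h
  rw [← ht, bracketGram_eq_zero e (mem_derivedOrthogonal_of_bracketGram he h hsymm)]

/-- Elements orthogonal to the derived algebra are annihilated by left multiplications. -/
lemma product_eq_zero_of_mem_derivedOrthogonal
    (hsymm : ∀ u v : g, B u v = B v u) (hpos : ∀ u : g, u ≠ 0 → 0 < B u u)
    (h1 : ∀ u v : g, A u v - A v u = ⁅u, v⁆)
    (h2 : ∀ u v w : g, B (A u v) w + B v (A u w) = 0)
    (h3 : ∀ u v w : g, ⁅A u v, w⁆ + ⁅u, A w v⁆ = 0) {s : g}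
    (hs : s ∈ derivedOrthogonal B) (u : g) : A u s = 0 := by
  have heq : ∀ z : g, B z z = 0 → z = 0 := fun z hz => by
    by_contra h
    exact (hpos z h).ne' hz
  have symm' : ∀ u v, B (A u s) v = B (A v s) u := fun u v => by
    have := hs u v
    rw [← h1, map_sub, LinearMap.sub_apply] at this
    linarith [h2 u s v, h2 v s u, hsymm s (A u v), hsymm s (A v u)]
  have hss : A s s = 0 := heq _ (by
    have := h2 (A s s) s s
    rw [symm' s (A s s)]
    linarith [hsymm s (A (A s s) s)])
  have hlie : ∀ w, A s (A w s) = A (A w s) s := fun w => by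
    have := h3 s s w
    rw [hss, zero_lie, zero_add, ← h1] at this
    exact sub_eq_zero.1 this
  have hR2 : ∀ w, B (A (A w s) s) (A w s) = 0 := fun w => by
    rw [← hlie]
    linarith [h2 s (A w s) (A w s), hsymm (A s (A w s)) (A w s)]
  have hR3 : ∀ w z, B (A (A w s) s) (A z s) = 0 := fun w z => by
    have := hR2 (w + z)
    simp only [map_add, LinearMap.add_apply] at this
    linarith [hR2 w, hR2 z, symm' (A w s) (A z s)]
  have hRR : ∀ w, A (A w s) s = 0 := fun w => heq _ (hR3 w (A w s))
  exact heq _ (by rw [symm' u (A u s), hRR]; simp)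

lemma adSkewSymmPart_eq_derivedOrthogonal [FiniteDimensional ℝ g]
    (hsymm : ∀ u v : g, B u v = B v u) (hpos : ∀ u : g, u ≠ 0 → 0 < B u u)
    (h1 : ∀ u v : g, A u v - A v u = ⁅u, v⁆)
    (h2 : ∀ u v w : g, B (A u v) w + B v (A u w) = 0)
    (h3 : ∀ u v w : g, ⁅A u v, w⁆ + ⁅u, A w v⁆ = 0) :
    adSkewSymmPart B = derivedOrthogonal B := by
  have hD := fun {u w : g} => lie_eq_zero_of_mem_orthogonal hsymm hpos h1 h2 h3 (u := u) (w := w)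
  have hle : derivedOrthogonal B ≤ adSkewSymmPart B := fun s hs u v => by
    rw [← h1, ← h1, product_eq_zero_of_mem_derivedOrthogonal hsymm hpos h1 h2 h3 hs,
      product_eq_zero_of_mem_derivedOrthogonal hsymm hpos h1 h2 h3 hs, sub_zero, sub_zero, h2]
  have hlie : ∀ u v, ⁅u, v⁆ ∈ B.orthogonal (derivedOrthogonal B) :=
    fun u v n hn => (hsymm _ _).trans (hn _ _)
  have hdec : ∀ x : g, ∃ n ∈ derivedOrthogonal B,
      ∃ d ∈ B.orthogonal (derivedOrthogonal B), n + d = x := fun x =>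
    Submodule.mem_sup.1 ((isCompl_orthogonal_of_pos hsymm hpos
      (derivedOrthogonal B)).sup_eq_top ▸ Submodule.mem_top (x := x))
  refine le_antisymm (fun s hs => ?_) hle
  obtain ⟨n, hn, d, hd, rfl⟩ := hdec s
  have hd' : d ∈ adSkewSymmPart B := by
    simpa using Submodule.sub_mem _ hs (hle hn)
  have hcentral : ∀ x : g, ⁅d, x⁆ = 0 := fun x => by
    have := hd' x ⁅d, x⁆
    rw [hD hd (hlie d x), map_zero, add_zero] at this
    by_contra h
    exact (hpos _ h).ne' this
  have hn_lie : ∀ n ∈ derivedOrthogonal B, ∀ v, B ⁅n, v⁆ d = 0 := fun n hn v => by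
    have := hle hn v d
    rwa [← lie_skew n d, hcentral, neg_zero, map_zero, add_zero] at this
  refine Submodule.add_mem _ hn fun u v => ?_
  obtain ⟨u₀, hu₀, u₁, hu₁, rfl⟩ := hdec u
  obtain ⟨v₀, hv₀, v₁, hv₁, rfl⟩ := hdec v
  rw [add_lie, lie_add u₁, hD hu₁ hv₁, add_zero, map_add, LinearMap.add_apply,
    hn_lie _ hu₀, ← lie_skew, map_neg, LinearMap.neg_apply, hn_lie _ hv₀]
  simp

end PseudoRiemannian

/-- Boucetta's characterization: a real Lie algebra with a positive definite scalar
product `B` admits a product `A` making it a (pseudo-)Riemann-Lie algebra if and only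
if the skew-adjoint part `S` is an abelian subalgebra, `U = S^⊥` is an abelian Lie
ideal, and `g = S ⊕ U` as an orthogonal direct sum. -/
theorem riemann_lie_algebra_characterization
    {g : Type*} [LieRing g] [LieAlgebra ℝ g] [FiniteDimensional ℝ g]
    (B : LinearMap.BilinForm ℝ g)
    (hsymm : ∀ u v : g, B u v = B v u)
    (hpos : ∀ u : g, u ≠ 0 → 0 < B u u) :
    (∃ A : g →ₗ[ℝ] g →ₗ[ℝ] g,
        (∀ u v : g, A u v - A v u = ⁅u, v⁆) ∧
        (∀ u v w : g, B (A u v) w + B v (A u w) = 0) ∧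
        (∀ u v w : g, ⁅A u v, w⁆ + ⁅u, A w v⁆ = 0)) ↔
      ((∀ s ∈ adSkewSymmPart B, ∀ s' ∈ adSkewSymmPart B, ⁅s, s'⁆ = 0) ∧
        (∀ t ∈ B.orthogonal (adSkewSymmPart B),
          ∀ t' ∈ B.orthogonal (adSkewSymmPart B), ⁅t, t'⁆ = 0) ∧
        (∀ x : g, ∀ t ∈ B.orthogonal (adSkewSymmPart B),
            ⁅x, t⁆ ∈ B.orthogonal (adSkewSymmPart B)) ∧
        IsCompl (adSkewSymmPart B) (B.orthogonal (adSkewSymmPart B))) := by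
  constructor
  · rintro ⟨A, h1, h2, h3⟩
    rw [adSkewSymmPart_eq_derivedOrthogonal hsymm hpos h1 h2 h3]
    refine ⟨fun s hs s' hs' => ?_, fun t ht t' ht' =>
      lie_eq_zero_of_mem_orthogonal hsymm hpos h1 h2 h3 ht ht',
      fun x t _ n hn => (hsymm _ _).trans (hn _ _), isCompl_orthogonal_of_pos hsymm hpos _⟩
    rw [← h1, product_eq_zero_of_mem_derivedOrthogonal hsymm hpos h1 h2 h3 hs,
      product_eq_zero_of_mem_derivedOrthogonal hsymm hpos h1 h2 h3 hs', sub_zero]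
  · rintro ⟨hS, hU, hI, hc⟩
    obtain ⟨p, hpS, hpU⟩ : ∃ p : g →ₗ[ℝ] g, (∀ x, p x ∈ adSkewSymmPart B) ∧
        ∀ x, x - p x ∈ B.orthogonal (adSkewSymmPart B) := by
      refine ⟨Submodule.projection _ _ hc, Submodule.projection_apply_mem hc, fun x => ?_⟩
      rw [← Submodule.projection_apply_eq_zero_iff hc, map_sub,
        Submodule.projection_apply_of_mem_left hc (Submodule.projection_apply_mem hc x), sub_self]
    have lieS : ∀ s ∈ adSkewSymmPart B, ∀ v, ⁅s, v⁆ = ⁅s, v - p v⁆ := fun s hs v => by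
      rw [lie_sub, hS s hs _ (hpS v), sub_zero]
    have lieU : ∀ t ∈ B.orthogonal (adSkewSymmPart B), ∀ v, ⁅t, v⁆ = ⁅t, p v⁆ := fun t ht v => by
      rw [← sub_eq_zero, ← lie_sub, hU t ht _ (hpU v)]
    have lieU' : ∀ t ∈ B.orthogonal (adSkewSymmPart B), ∀ v, ⁅v, t⁆ = ⁅p v, t⁆ := fun t ht v => by
      rw [← lie_skew, lieU t ht, lie_skew]
    refine ⟨(LieModule.toEnd ℝ g g : g →ₗ[ℝ] g →ₗ[ℝ] g) ∘ₗ p, fun u v => ?_,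
      fun u v w => hpS u v w, fun u v w => ?_⟩
    · change ⁅p u, v⁆ - ⁅p v, u⁆ = ⁅u, v⁆
      have h := hU _ (hpU u) _ (hpU v)
      rw [sub_lie, lie_sub, lie_sub, hS _ (hpS u) _ (hpS v), ← lie_skew u (p v)] at h
      rw [← sub_eq_zero, ← neg_eq_zero, ← h]
      abel
    · change ⁅⁅p u, v⁆, w⁆ + ⁅u, ⁅p w, v⁆⁆ = 0
      rw [lieS _ (hpS u) v, lieS _ (hpS w) v, lieU _ (hI _ _ (hpU v)),
        lieU' _ (hI _ _ (hpU v)), leibniz_lie (p u) (p w), hS _ (hpS u) _ (hpS w), zero_lie,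
        zero_add, ← lie_skew _ (p w)]
      simp
end

section
/- Let (g, B, A) be a finite-dimensional Riemann-Lie algebra (a real pseudo-Riemannian Lie algebra whose bilinear form B is positive definite), and let S = {s ∈ g : B(⁅s, u⁆, v) + B(u, ⁅s, v⁆) = 0 for all u, v ∈ g}. Then the orthogonal complement S^⊥ equals the linear span of {A u v + A v u : u, v ∈ g}, which in turn equals the linear span of {A u v : u, v ∈ g}. -/
/-- The map `ad s` is skew-symmetric if and only if `u ↦ A u s` is. -/
theorem mem_adSkewSymmPart_iff {g : Type*} [LieRing g] [LieAlgebra ℝ g]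
    {B : LinearMap.BilinForm ℝ g} {A : g →ₗ[ℝ] g →ₗ[ℝ] g}
    (PR1 : ∀ u v : g, A u v - A v u = ⁅u, v⁆)
    (PR2 : ∀ u v w : g, B (A u v) w + B v (A u w) = 0) {s : g} :
    s ∈ adSkewSymmPart B ↔ ∀ u v : g, B (A u s) v + B u (A v s) = 0 := by
  have key (u v : g) :
      B ⁅s, u⁆ v + B u ⁅s, v⁆ = -(B (A u s) v + B u (A v s)) := by
    have h := PR2 s u v
    simp only [← PR1, map_sub, LinearMap.sub_apply]
    linarith
  change (∀ u v : g, B ⁅s, u⁆ v + B u ⁅s, v⁆ = 0) ↔ _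
  simp only [key, neg_eq_zero]

/-- In a Riemann-Lie algebra, elements with skew-symmetric adjoint action are parallel. -/
theorem apply_eq_zero_of_mem_adSkewSymmPart {g : Type*} [LieRing g] [LieAlgebra ℝ g]
    {B : LinearMap.BilinForm ℝ g}
    (hsymm : ∀ u v : g, B u v = B v u)
    (hpos : ∀ u : g, u ≠ 0 → 0 < B u u)
    {A : g →ₗ[ℝ] g →ₗ[ℝ] g}
    (PR1 : ∀ u v : g, A u v - A v u = ⁅u, v⁆)
    (PR2 : ∀ u v w : g, B (A u v) w + B v (A u w) = 0)
    (PR3 : ∀ u v w : g, ⁅A u v, w⁆ + ⁅u, A w v⁆ = 0)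
    {s : g} (hs : s ∈ adSkewSymmPart B) (u : g) : A u s = 0 := by
  have hdef (x : g) (hx : B x x = 0) : x = 0 := by
    by_contra h
    exact (hpos x h).ne' hx
  have hskew := (mem_adSkewSymmPart_iff PR1 PR2).1 hs
  have hss : A s s = 0 := by
    apply hdef
    have h1 := hskew s (A s s)
    have h2 := PR2 (A s s) s s
    have h3 := hsymm (A (A s s) s) s
    linarith
  have hcomm (v : g) : A s (A v s) = A (A v s) s := by
    have h := PR3 v s s
    rw [hss, lie_zero, add_zero, ← lie_skew, ← PR1, neg_eq_zero] at h
    exact sub_eq_zero.1 h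
  have hbracket (v w : g) : B s ⁅A (A v s) s, w⁆ = 0 := by
    have h := PR3 s (A v s) w
    rw [hcomm] at h
    rw [eq_neg_of_add_eq_zero_left h, map_neg, neg_eq_zero]
    have h1 := hs s (A w (A v s))
    simpa using h1
  have hbracket_eq (y w : g) : B s ⁅y, w⁆ = -2 * B (A y s) w := by
    rw [← PR1, map_sub]
    have h1 := PR2 y s w
    have h2 := PR2 w s y
    have h3 := hskew y w
    have h4 := hsymm y (A w s)
    linarith
  have hcube (v : g) : A (A (A v s) s) s = 0 := by
    apply hdef
    have h := hbracket_eq (A (A v s) s) (A (A (A v s) s) s)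
    rw [hbracket] at h
    linarith
  have hker (v : g) (hv : A (A v s) s = 0) : A v s = 0 := by
    apply hdef
    have h := hskew v (A v s)
    rwa [hv, map_zero, add_zero] at h
  exact hker u (hker _ (hcube u))

/-- In a finite-dimensional Riemann-Lie algebra, `S^⊥` equals the span of
`{A u v + A v u}`, which equals the span of `{A u v}`. -/
theorem riemann_orthogonal_skew_part
    {g : Type*} [LieRing g] [LieAlgebra ℝ g] [FiniteDimensional ℝ g]
    (B : LinearMap.BilinForm ℝ g)
    (hsymm : ∀ u v : g, B u v = B v u)
    (hpos : ∀ u : g, u ≠ 0 → 0 < B u u)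
    (A : g →ₗ[ℝ] g →ₗ[ℝ] g)
    (PR1 : ∀ u v : g, A u v - A v u = ⁅u, v⁆)
    (PR2 : ∀ u v w : g, B (A u v) w + B v (A u w) = 0)
    (PR3 : ∀ u v w : g, ⁅A u v, w⁆ + ⁅u, A w v⁆ = 0) :
    B.orthogonal (adSkewSymmPart B) =
        Submodule.span ℝ {z : g | ∃ u v : g, A u v + A v u = z} ∧
      Submodule.span ℝ {z : g | ∃ u v : g, A u v + A v u = z} =
        Submodule.span ℝ {z : g | ∃ u v : g, A u v = z} := by
  have hrefl : B.IsRefl := fun u v h => (hsymm v u).trans h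
  have hnondeg : B.Nondegenerate := by
    refine (LinearMap.IsRefl.nondegenerate_iff_separatingLeft hrefl).2 fun u hu => ?_
    by_contra h
    exact (hpos u h).ne' (hu u)
  have horth : adSkewSymmPart B =
      B.orthogonal (Submodule.span ℝ {z : g | ∃ u v : g, A u v + A v u = z}) := by
    ext s
    have key (u v : g) :
        B (A u s) v + B u (A v s) = -B s (A u v + A v u) := by
      have h1 := PR2 u s v
      have h2 := PR2 v s u
      have h3 := hsymm u (A v s)
      rw [map_add]
      linarith
    rw [mem_adSkewSymmPart_iff PR1 PR2, LinearMap.BilinForm.mem_orthogonal_iff]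
    simp only [key, neg_eq_zero]
    constructor
    · intro h z hz
      change B z s = 0
      rw [hsymm]
      have hle : Submodule.span ℝ {z : g | ∃ u v : g, A u v + A v u = z} ≤
          LinearMap.ker (B s) := by
        rw [Submodule.span_le]
        rintro _ ⟨u, v, rfl⟩
        exact h u v
      exact hle hz
    · intro h u v
      rw [hsymm]
      exact h _ (Submodule.subset_span ⟨u, v, rfl⟩)
  have hperp : B.orthogonal (adSkewSymmPart B) =
      Submodule.span ℝ {z : g | ∃ u v : g, A u v + A v u = z} := by
    rw [horth, LinearMap.BilinForm.orthogonal_orthogonal hnondeg hrefl]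
  refine ⟨hperp, le_antisymm ?_ ?_⟩
  · rw [Submodule.span_le]
    rintro _ ⟨u, v, rfl⟩
    exact add_mem (Submodule.subset_span ⟨u, v, rfl⟩) (Submodule.subset_span ⟨v, u, rfl⟩)
  · rw [← hperp, Submodule.span_le]
    rintro _ ⟨u, v, rfl⟩ s hs
    have h := PR2 u s v
    rwa [apply_eq_zero_of_mem_adSkewSymmPart hsymm hpos PR1 PR2 PR3 hs, map_zero,
      LinearMap.zero_apply, zero_add] at h
end

section
/- Let (g, B, A) be a 3-dimensional non-abelian Riemann-Lie algebra (a real pseudo-Riemannian Lie algebra whose bilinear form B is positive definite, with dim g = 3 and ⁅g, g⁆ ≠ 0). Then dim ⁅g, g⁆ = 2, and there exist a B-orthonormal basis s, x, y of g and a real number a such that s ∈ Z_r(g) = {u : A v u = 0 for all v}, x, y ∈ ⁅g, g⁆, and ⁅s, x⁆ = A s x = a·y, ⁅s, y⁆ = A s y = −a·x. -/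
/-- `B` and `A` form a Riemann-Lie structure on `g`. -/
structure IsRiemannLie {g : Type*} [LieRing g] [LieAlgebra ℝ g]
    (B : LinearMap.BilinForm ℝ g) (A : g →ₗ[ℝ] g →ₗ[ℝ] g) : Prop where
  symm : ∀ u v : g, B u v = B v u
  pos : ∀ u : g, u ≠ 0 → 0 < B u u
  sub_eq_lie : ∀ u v : g, A u v - A v u = ⁅u, v⁆
  skew : ∀ u v w : g, B (A u v) w + B v (A u w) = 0
  lie_add_lie : ∀ u v w : g, ⁅A u v, w⁆ + ⁅u, A w v⁆ = 0

/-- Three vectors that are orthonormal for the bilinear form `B`. -/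
structure IsOrthonormalTriple {V : Type*} [AddCommGroup V] [Module ℝ V]
    (B : LinearMap.BilinForm ℝ V) (x y z : V) : Prop where
  xx : B x x = 1
  yy : B y y = 1
  zz : B z z = 1
  xy : B x y = 0
  yz : B y z = 0
  zx : B z x = 0

section BilinearForm

variable {V : Type*} [AddCommGroup V] [Module ℝ V] {B : LinearMap.BilinForm ℝ V}

theorem IsOrthonormalTriple.rotate {x y z : V} (h : IsOrthonormalTriple B x y z) :
    IsOrthonormalTriple B y z x :=
  ⟨h.yy, h.zz, h.xx, h.yz, h.zx, h.xy⟩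

theorem IsOrthonormalTriple.expand [FiniteDimensional ℝ V] (hdim : Module.finrank ℝ V = 3)
    (hsymm : ∀ u v : V, B u v = B v u) {x y z : V} (h : IsOrthonormalTriple B x y z) (v : V) :
    v = B x v • x + B y v • y + B z v • z := by
  let f : V →ₗ[ℝ] (Fin 3 → ℝ) := LinearMap.pi ![B x, B y, B z]
  have hyx := (hsymm y x).trans h.xy
  have hzy := (hsymm z y).trans h.yz
  have hxz := (hsymm x z).trans h.zx
  have hf : ∀ a b c : ℝ, f (a • x + b • y + c • z) = ![a, b, c] := by
    intro a b c
    ext i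
    fin_cases i <;> simp [f, h.xx, h.yy, h.zz, h.xy, h.yz, h.zx, hyx, hzy, hxz]
  have hsurj : Function.Surjective f := fun c =>
    ⟨c 0 • x + c 1 • y + c 2 • z, by rw [hf]; ext i; fin_cases i <;> rfl⟩
  have hinj : Function.Injective f :=
    (LinearMap.injective_iff_surjective_of_finrank_eq_finrank (by simp [hdim])).2 hsurj
  apply hinj
  rw [hf]
  ext i
  fin_cases i <;> rfl

theorem IsOrthonormalTriple.coord_eq_zero (hsymm : ∀ u v : V, B u v = B v u) {x y z : V}
    (h : IsOrthonormalTriple B x y z) {a b c : ℝ} (habc : a • x + b • y + c • z = 0) :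
    a = 0 ∧ b = 0 ∧ c = 0 := by
  have hyx := (hsymm y x).trans h.xy
  have hzy := (hsymm z y).trans h.yz
  have hxz := (hsymm x z).trans h.zx
  have h1 := congrArg (B x) habc
  have h2 := congrArg (B y) habc
  have h3 := congrArg (B z) habc
  simp only [map_add, map_smul, smul_eq_mul, map_zero, h.xx, h.yy, h.zz, h.xy, h.yz, h.zx,
    hyx, hzy, hxz] at h1 h2 h3
  exact ⟨by linarith, by linarith, by linarith⟩

theorem exists_unit_smul (hpos : ∀ u : V, u ≠ 0 → 0 < B u u) {v : V} (hv : v ≠ 0) :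
    ∃ c : ℝ, B (c • v) (c • v) = 1 := by
  refine ⟨(√(B v v))⁻¹, ?_⟩
  have h := hpos v hv
  have hs := Real.mul_self_sqrt h.le
  have h0 : √(B v v) ≠ 0 := ne_of_gt (Real.sqrt_pos.2 h)
  simp only [map_smul, LinearMap.smul_apply, smul_eq_mul]
  field_simp
  nlinarith

theorem exists_unit_orthogonal [FiniteDimensional ℝ V] (hdim : Module.finrank ℝ V = 3)
    (hpos : ∀ u : V, u ≠ 0 → 0 < B u u) (x y : V) :
    ∃ z : V, B z z = 1 ∧ B x z = 0 ∧ B y z = 0 := by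
  let f : V →ₗ[ℝ] (Fin 2 → ℝ) := LinearMap.pi ![B x, B y]
  have hker : LinearMap.ker f ≠ ⊥ := LinearMap.ker_ne_bot_of_finrank_lt (by simp [hdim])
  obtain ⟨v, hv, hv0⟩ := Submodule.exists_mem_ne_zero_of_ne_bot hker
  obtain ⟨c, hc⟩ := exists_unit_smul hpos hv0
  have hx : B x v = 0 := congrFun (LinearMap.mem_ker.1 hv) 0
  have hy : B y v = 0 := congrFun (LinearMap.mem_ker.1 hv) 1
  exact ⟨c • v, hc, by simp [hx], by simp [hy]⟩

theorem exists_isOrthonormalTriple [FiniteDimensional ℝ V] (hdim : Module.finrank ℝ V = 3)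
    (hsymm : ∀ u v : V, B u v = B v u) (hpos : ∀ u : V, u ≠ 0 → 0 < B u u)
    {x : V} (hx : B x x = 1) : ∃ y z : V, IsOrthonormalTriple B x y z := by
  obtain ⟨y, hyy, hxy, -⟩ := exists_unit_orthogonal hdim hpos x x
  obtain ⟨z, hzz, hxz, hyz⟩ := exists_unit_orthogonal hdim hpos x y
  exact ⟨y, z, hx, hyy, hzz, hxy, hyz, (hsymm z x).trans hxz⟩

end BilinearForm

section RiemannLie

variable {g : Type*} [LieRing g] [LieAlgebra ℝ g] {B : LinearMap.BilinForm ℝ g}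
  {A : g →ₗ[ℝ] g →ₗ[ℝ] g}

theorem IsRiemannLie.apply_self (hA : IsRiemannLie B A) (u v : g) : B v (A u v) = 0 := by
  have h := hA.skew u v v
  rw [hA.symm (A u v) v] at h
  linarith

theorem IsRiemannLie.apply_swap (hA : IsRiemannLie B A) (u v w : g) :
    B v (A u w) = -B w (A u v) := by
  have h := hA.skew u v w
  rw [hA.symm (A u v) w] at h
  linarith

/-- In an orthonormal triple, the skew operator `A u` is a cross product. -/
theorem IsRiemannLie.exists_cross [FiniteDimensional ℝ g] (hdim : Module.finrank ℝ g = 3)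
    (hA : IsRiemannLie B A) {x y z : g} (h : IsOrthonormalTriple B x y z) :
    ∃ p q r : g → ℝ, ∀ u, A u x = r u • y - q u • z ∧ A u y = p u • z - r u • x ∧
      A u z = q u • x - p u • y := by
  refine ⟨fun u => B z (A u y), fun u => B x (A u z), fun u => B y (A u x), fun u => ?_⟩
  have aux : ∀ {a b c : g}, IsOrthonormalTriple B a b c →
      A u a = B b (A u a) • b - B a (A u c) • c := by
    intro a b c habc
    conv_lhs => rw [habc.expand hdim hA.symm (A u a)]
    rw [hA.apply_self, hA.apply_swap u c a]
    module
  exact ⟨aux h, aux h.rotate, aux h.rotate.rotate⟩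

theorem eq_zero_of_lie_triple [FiniteDimensional ℝ g] (hdim : Module.finrank ℝ g = 3)
    (hsymm : ∀ u v : g, B u v = B v u) {x y z : g} (h : IsOrthonormalTriple B x y z)
    (hxy : ⁅x, y⁆ = 0) (hyz : ⁅y, z⁆ = 0) (hzx : ⁅z, x⁆ = 0) (u v : g) : ⁅u, v⁆ = 0 := by
  have hyx : ⁅y, x⁆ = 0 := by rw [← lie_skew, hxy, neg_zero]
  have hzy : ⁅z, y⁆ = 0 := by rw [← lie_skew, hyz, neg_zero]
  have hxz : ⁅x, z⁆ = 0 := by rw [← lie_skew, hzx, neg_zero]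
  rw [h.expand hdim hsymm u, h.expand hdim hsymm v]
  simp [hxy, hyz, hzx, hyx, hzy, hxz]

/-- The matrix of `A` in an orthonormal triple is symmetric unless `g` is abelian. -/
theorem IsRiemannLie.symm_of_nonabelian [FiniteDimensional ℝ g] (hdim : Module.finrank ℝ g = 3)
    (hA : IsRiemannLie B A) (hnab : ¬ ∀ u v : g, ⁅u, v⁆ = 0)
    {x y z : g} (h : IsOrthonormalTriple B x y z) {p q r : g → ℝ}
    (hx : ∀ u, A u x = r u • y - q u • z) (hy : ∀ u, A u y = p u • z - r u • x)
    (hz : ∀ u, A u z = q u • x - p u • y) :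
    q x = p y := by
  by_contra hne
  apply hnab
  have hyx : ⁅y, x⁆ = -⁅x, y⁆ := (lie_skew y x).symm
  have hzy : ⁅z, y⁆ = -⁅y, z⁆ := (lie_skew z y).symm
  have hxz : ⁅x, z⁆ = -⁅z, x⁆ := (lie_skew x z).symm
  have d : q x - p y ≠ 0 := sub_ne_zero.2 hne
  have e1 := hA.lie_add_lie x z y
  have e2 := hA.lie_add_lie x z z
  have e3 := hA.lie_add_lie x y y
  have e4 := hA.lie_add_lie x x y
  have e5 := hA.lie_add_lie y z z
  simp only [hx, hy, hz, sub_lie, lie_sub, smul_lie, lie_smul, lie_self, hyx, hzy, hxz,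
    smul_zero, sub_zero, zero_sub, smul_neg] at e1 e2 e3 e4 e5
  have n3 : ⁅x, y⁆ = 0 := by
    refine (smul_eq_zero.1 (?_ : (q x - p y) • ⁅x, y⁆ = 0)).resolve_left d
    linear_combination (norm := module) (1 : ℝ) • e1
  have n2 : ⁅z, x⁆ = 0 := by
    refine (smul_eq_zero.1 (?_ : (q x - p y) • ⁅z, x⁆ = 0)).resolve_left d
    rw [n3] at e2 e3
    linear_combination (norm := module) (1 : ℝ) • e3 - (1 : ℝ) • e2
  have n1 : ⁅y, z⁆ = 0 := by
    refine (smul_eq_zero.1 (?_ : (q x - p y) • ⁅y, z⁆ = 0)).resolve_left d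
    rw [n3] at e4 e5
    linear_combination (norm := module) (1 : ℝ) • e4 + (1 : ℝ) • e5
  exact eq_zero_of_lie_triple hdim hA.symm h n3 n1 n2

/-- A three-dimensional non-abelian Riemann-Lie algebra has a nonzero element `s` with
`A v s = 0` for all `v`. -/
theorem IsRiemannLie.exists_apply_eq_zero [FiniteDimensional ℝ g]
    (hdim : Module.finrank ℝ g = 3) (hA : IsRiemannLie B A)
    (hnab : ¬ ∀ u v : g, ⁅u, v⁆ = 0) : ∃ s : g, s ≠ 0 ∧ ∀ v, A v s = 0 := by
  obtain ⟨x, hxx, -⟩ := exists_unit_orthogonal hdim hA.pos 0 0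
  obtain ⟨y, z, h⟩ := exists_isOrthonormalTriple hdim hA.symm hA.pos hxx
  obtain ⟨p, q, r, hpqr⟩ := hA.exists_cross hdim h
  have hx := fun u => (hpqr u).1
  have hy := fun u => (hpqr u).2.1
  have hz := fun u => (hpqr u).2.2
  have s1 := hA.symm_of_nonabelian hdim hnab h hx hy hz
  have s2 := hA.symm_of_nonabelian hdim hnab h.rotate hy hz hx
  have s3 := hA.symm_of_nonabelian hdim hnab h.rotate.rotate hz hx hy
  have n1 : ⁅y, z⁆ = (q y + r z) • x - p y • y - p z • z := by
    rw [← hA.sub_eq_lie, hz, hy]; module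
  have n2 : ⁅z, x⁆ = (r z + p x) • y - q z • z - q x • x := by
    rw [← hA.sub_eq_lie, hx, hz]; module
  have n3 : ⁅x, y⁆ = (p x + q y) • z - r x • x - r y • y := by
    rw [← hA.sub_eq_lie, hy, hx]; module
  have m1 : ⁅y, x⁆ = -⁅x, y⁆ := (lie_skew y x).symm
  have m2 : ⁅z, y⁆ = -⁅y, z⁆ := (lie_skew z y).symm
  have m3 : ⁅x, z⁆ = -⁅z, x⁆ := (lie_skew x z).symm
  have e1 := hA.lie_add_lie x z z
  have e2 := hA.lie_add_lie y x x
  have e3 := hA.lie_add_lie z y y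
  simp only [hx, hy, hz, sub_lie, lie_sub, smul_lie, lie_smul, lie_self, m1, m2, m3, n1, n2, n3]
    at e1 e2 e3
  obtain ⟨a1, a2, a3⟩ := h.coord_eq_zero hA.symm
    (a := q x * q x - p x * (q y + r z) + p z * r x)
    (b := -q x * (r z + p x) + p x * p y + p z * r y)
    (c := q x * q z + p x * p z - p z * (p x + q y)) (by rw [← e1]; module)
  obtain ⟨b1, b2, b3⟩ := h.rotate.coord_eq_zero hA.symm
    (a := r y * r y - q y * (r z + p x) + q x * p y)
    (b := -r y * (p x + q y) + q y * q z + q x * p z)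
    (c := r y * r x + q y * q x - q x * (q y + r z)) (by rw [← e2]; module)
  obtain ⟨c1, c2, c3⟩ := h.rotate.rotate.coord_eq_zero hA.symm
    (a := p z * p z - r z * (p x + q y) + r y * q z)
    (b := -p z * (q y + r z) + r z * r x + r y * q x)
    (c := p z * p y + r z * r y - r y * (r z + p x)) (by rw [← e3]; module)
  simp only [← s1, s2, s3] at a1 a2 a3 b1 b2 b3 c1 c2 c3
  have m12 : p x * q y = q x * q x := by linarith
  have m13 : p x * r z = r x * r x := by linarith
  have m23 : q y * r z = q z * q z := by linarith
  have o1 : p x * q z = q x * r x := by linarith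
  have o2 : q y * r x = q x * q z := by linarith
  have o3 : r z * q x = r x * q z := by linarith
  by_contra! hno
  have key : ∀ a b c : ℝ, (∀ u ∈ ({x, y, z} : Set g),
      b * r u = c * q u ∧ c * p u = a * r u ∧ a * q u = b * p u) → a = 0 ∧ b = 0 ∧ c = 0 := by
    intro a b c H
    have hzero : ∀ u ∈ ({x, y, z} : Set g), A u (a • x + b • y + c • z) = 0 := by
      intro u hu
      obtain ⟨h1, h2, h3⟩ := H u hu
      simp only [map_add, map_smul, hx, hy, hz]
      match_scalars <;> linarith
    refine h.coord_eq_zero hA.symm (by_contra fun hs => ?_)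
    obtain ⟨v, hv⟩ := hno _ hs
    apply hv
    rw [h.expand hdim hA.symm v]
    simp only [map_add (A), map_smul (A), LinearMap.add_apply, LinearMap.smul_apply,
      hzero x (by simp), hzero y (by simp), hzero z (by simp), smul_zero, add_zero]
  obtain ⟨x1, x2, x3⟩ := key (p x) (q x) (r x) (by
    rintro u (rfl | rfl | rfl) <;> (try simp only [← s1, s2, s3]) <;> refine ⟨?_, ?_, ?_⟩ <;>
      linarith)
  obtain ⟨y1, y2, y3⟩ := key (q x) (q y) (q z) (by
    rintro u (rfl | rfl | rfl) <;> (try simp only [← s1, s2, s3]) <;> refine ⟨?_, ?_, ?_⟩ <;>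
      linarith)
  obtain ⟨z1, z2, z3⟩ := key (r x) (q z) (r z) (by
    rintro u (rfl | rfl | rfl) <;> (try simp only [← s1, s2, s3]) <;> refine ⟨?_, ?_, ?_⟩ <;>
      linarith)
  rw [x1, y2, x3, s2, y3] at n3
  rw [y2, z3, ← s1, x2, s3, x3] at n1
  rw [x1, z3, x2, y3] at n2
  exact hnab (eq_zero_of_lie_triple hdim hA.symm h (by simp [n3]) (by simp [n1]) (by simp [n2]))

end RiemannLie

/-- A 3-dimensional non-abelian Riemann-Lie algebra has 2-dimensional derived algebra,
and there is an orthonormal basis `s, x, y` with `s ∈ Z_r(g)`, `x, y ∈ ⁅g,g⁆`,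
`⁅s,x⁆ = A s x = a•y` and `⁅s,y⁆ = A s y = −a•x` for some real `a`. -/
theorem riemann_dim_three_structure
    {g : Type*} [LieRing g] [LieAlgebra ℝ g] [FiniteDimensional ℝ g]
    (hdim : Module.finrank ℝ g = 3)
    (hnab : ¬ ∀ u v : g, ⁅u, v⁆ = 0)
    (B : LinearMap.BilinForm ℝ g)
    (hsymm : ∀ u v : g, B u v = B v u)
    (hpos : ∀ u : g, u ≠ 0 → 0 < B u u)
    (A : g →ₗ[ℝ] g →ₗ[ℝ] g)
    (PR1 : ∀ u v : g, A u v - A v u = ⁅u, v⁆)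
    (PR2 : ∀ u v w : g, B (A u v) w + B v (A u w) = 0)
    (PR3 : ∀ u v w : g, ⁅A u v, w⁆ + ⁅u, A w v⁆ = 0) :
    Module.finrank ℝ (Submodule.span ℝ {z : g | ∃ x y : g, ⁅x, y⁆ = z}) = 2 ∧
    ∃ (s x y : g) (a : ℝ),
      Submodule.span ℝ {s, x, y} = ⊤ ∧
      B s s = 1 ∧ B x x = 1 ∧ B y y = 1 ∧
      B s x = 0 ∧ B s y = 0 ∧ B x y = 0 ∧
      (∀ v : g, A v s = 0) ∧
      x ∈ Submodule.span ℝ {z : g | ∃ u v : g, ⁅u, v⁆ = z} ∧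
      y ∈ Submodule.span ℝ {z : g | ∃ u v : g, ⁅u, v⁆ = z} ∧
      ⁅s, x⁆ = a • y ∧ A s x = a • y ∧
      ⁅s, y⁆ = -a • x ∧ A s y = -a • x := by
  have hA : IsRiemannLie B A := ⟨hsymm, hpos, PR1, PR2, PR3⟩
  obtain ⟨s₀, hs₀, hker₀⟩ := hA.exists_apply_eq_zero hdim hnab
  obtain ⟨t, hss⟩ := exists_unit_smul hpos hs₀
  generalize hs : t • s₀ = s at hss
  have hker : ∀ v, A v s = 0 := fun v => by rw [← hs, map_smul, hker₀, smul_zero]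
  obtain ⟨x, y, h⟩ := exists_isOrthonormalTriple hdim hsymm hpos hss
  obtain ⟨p, q, r, hpqr⟩ := hA.exists_cross hdim h
  have hqr : ∀ u, q u = 0 ∧ r u = 0 := fun u => by
    obtain ⟨-, h2, h3⟩ := h.coord_eq_zero hsymm (a := 0) (b := r u) (c := -q u)
      (by rw [← hker u, (hpqr u).1]; module)
    exact ⟨neg_eq_zero.1 h3, h2⟩
  have hpx : p x = 0 := by
    rw [← hA.symm_of_nonabelian hdim hnab h (fun u => (hpqr u).1) (fun u => (hpqr u).2.1)
      (fun u => (hpqr u).2.2), (hqr s).1]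
  have hpy : p y = 0 := by
    rw [hA.symm_of_nonabelian hdim hnab h.rotate.rotate (fun u => (hpqr u).2.2)
      (fun u => (hpqr u).1) (fun u => (hpqr u).2.1), (hqr s).2]
  have hx : ∀ u, A u x = p u • y := fun u => by rw [(hpqr u).2.1, (hqr u).2]; module
  have hy : ∀ u, A u y = -p u • x := fun u => by rw [(hpqr u).2.2, (hqr u).1]; module
  have lsx : ⁅s, x⁆ = p s • y := by rw [← PR1, hx, hker, sub_zero]
  have lsy : ⁅s, y⁆ = -p s • x := by rw [← PR1, hy, hker, sub_zero]
  have lxy : ⁅x, y⁆ = 0 := by rw [← PR1, hx, hy, hpx, hpy]; module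
  have ha : p s ≠ 0 := fun ha => hnab (eq_zero_of_lie_triple hdim hsymm h
    (by simp [lsx, ha]) lxy (by rw [← lie_skew, lsy, ha]; simp))
  have hxmem : x ∈ Submodule.span ℝ {z : g | ∃ u v : g, ⁅u, v⁆ = z} :=
    Submodule.subset_span ⟨s, (-(p s)⁻¹) • y, by rw [lie_smul, lsy, smul_smul]; simp [ha]⟩
  have hymem : y ∈ Submodule.span ℝ {z : g | ∃ u v : g, ⁅u, v⁆ = z} :=
    Submodule.subset_span ⟨s, (p s)⁻¹ • x, by rw [lie_smul, lsx, smul_smul]; simp [ha]⟩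
  have hspan : Submodule.span ℝ {z : g | ∃ u v : g, ⁅u, v⁆ = z} =
      Submodule.span ℝ (Set.range ![x, y]) := by
    rw [Matrix.range_cons, Matrix.range_cons, Matrix.range_empty, Set.union_empty,
      Set.singleton_union]
    apply le_antisymm <;> rw [Submodule.span_le]
    · rintro _ ⟨u, v, rfl⟩
      refine Submodule.mem_span_pair.2
        ⟨p s * (B y u * B s v - B s u * B y v), p s * (B s u * B x v - B x u * B s v), ?_⟩
      have lxs : ⁅x, s⁆ = -(p s • y) := by rw [← lsx, lie_skew]
      have lys : ⁅y, s⁆ = p s • x := by rw [← lie_skew, lsy]; module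
      have lyx : ⁅y, x⁆ = 0 := by rw [← lie_skew, lxy, neg_zero]
      conv_rhs => rw [h.expand hdim hsymm u, h.expand hdim hsymm v]
      simp only [add_lie, lie_add, smul_lie, lie_smul, lie_self, lsx, lsy, lxy, lxs, lys, lyx]
      module
    · rintro _ (rfl | rfl)
      exacts [hxmem, hymem]
  have hli : LinearIndependent ℝ ![x, y] := by
    refine LinearIndependent.pair_iff.2 fun a b hab => ?_
    exact (h.coord_eq_zero hsymm (a := 0) (by rw [zero_smul, zero_add, hab])).2
  refine ⟨by rw [hspan, finrank_span_eq_card hli, Fintype.card_fin], s, x, y, p s, ?_, h.xx, h.yy,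
    h.zz, h.xy, (hsymm s y).trans h.zx, h.yz, hker, hxmem, hymem, lsx, hx s, lsy, hy s⟩
  refine eq_top_iff.2 fun v _ => Submodule.mem_span_triple.2 ?_
  exact ⟨_, _, _, (h.expand hdim hsymm v).symm⟩
end

section
/- Let (g, B, A) be a pseudo-Riemannian Lie algebra over a field F of characteristic 0 with dim g = 2. Then g is abelian, i.e., ⁅u, v⁆ = 0 for all u, v ∈ g. -/
/-- A `2 × 2` matrix (rows `(p, q)` and `(r, s)`) that is skew-symmetric for the nondegenerate
form with Gram matrix `!![a, b; b, c]` is a multiple of `!![-b, a; -c, b]`. -/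
theorem exists_eq_mul_of_skew {F : Type*} [Field F] {a b c p q r s : F}
    (hD : a * c - b * b ≠ 0) (h₁ : p * a + q * b = 0) (h₂ : r * b + s * c = 0)
    (h₃ : p * b + q * c + (r * a + s * b) = 0) :
    ∃ t : F, p = t * -b ∧ q = t * a ∧ r = t * -c ∧ s = t * b := by
  refine ⟨(p * b + q * c) / (a * c - b * b), ?_, ?_, ?_, ?_⟩ <;>
    rw [div_mul_eq_mul_div, eq_div_iff hD]
  · linear_combination c * h₁
  · linear_combination -b * h₁
  · linear_combination -b * h₂ + c * h₃
  · linear_combination a * h₂ - b * h₃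

/-- Every 2-dimensional pseudo-Riemannian Lie algebra over a field of characteristic 0
is abelian. -/
theorem pseudoRiemannian_dim_two_abelian
    {F : Type*} [Field F] [CharZero F]
    {g : Type*} [LieRing g] [LieAlgebra F g] [FiniteDimensional F g]
    (hdim : Module.finrank F g = 2)
    (B : LinearMap.BilinForm F g)
    (hsymm : ∀ u v : g, B u v = B v u)
    (hnd : ∀ u : g, (∀ v : g, B u v = 0) → u = 0)
    (A : g →ₗ[F] g →ₗ[F] g)
    (PR1 : ∀ u v : g, A u v - A v u = ⁅u, v⁆)
    (PR2 : ∀ u v w : g, B (A u v) w + B v (A u w) = 0)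
    (PR3 : ∀ u v w : g, ⁅A u v, w⁆ + ⁅u, A w v⁆ = 0) :
    ∀ u v : g, ⁅u, v⁆ = 0 := by
  let e := Module.finBasisOfFinrankEq F g hdim
  have expand (x : g) : x = e.repr x 0 • e 0 + e.repr x 1 • e 1 := by
    rw [← Fin.sum_univ_two (fun i => e.repr x i • e i), e.sum_repr]
  have indep {x y : F} (h : x • e 0 + y • e 1 = 0) : x = 0 ∧ y = 0 := by
    have h' := Fintype.linearIndependent_iff.1 e.linearIndependent ![x, y]
      (by simpa [Fin.sum_univ_two] using h)
    exact ⟨by simpa using h' 0, by simpa using h' 1⟩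
  have nondeg {x y : F} (h₀ : x * B (e 0) (e 0) + y * B (e 1) (e 0) = 0)
      (h₁ : x * B (e 0) (e 1) + y * B (e 1) (e 1) = 0) : x = 0 ∧ y = 0 := by
    refine indep (hnd _ fun v => ?_)
    rw [expand v]
    simp only [map_add, map_smul, LinearMap.add_apply, LinearMap.smul_apply, smul_eq_mul]
    linear_combination e.repr v 0 * h₀ + e.repr v 1 * h₁
  have hs := hsymm (e 1) (e 0)
  set a := B (e 0) (e 0) with ha
  set b := B (e 0) (e 1) with hb
  set c := B (e 1) (e 1) with hc
  have hD : a * c - b * b ≠ 0 := by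
    intro hD
    obtain ⟨hb0, ha0⟩ := nondeg (x := b) (y := -a) (by rw [hs]; ring)
      (by linear_combination -hD)
    exact one_ne_zero (nondeg (x := (1 : F)) (y := 0) (by simpa using ha0) (by simp [hb0])).1
  have skew (i : Fin 2) := exists_eq_mul_of_skew hD
    (p := e.repr (A (e i) (e 0)) 0) (q := e.repr (A (e i) (e 0)) 1)
    (r := e.repr (A (e i) (e 1)) 0) (s := e.repr (A (e i) (e 1)) 1)
    (by
      have h := PR2 (e i) (e 0) (e 0)
      rw [hsymm (e 0), ← two_mul, mul_eq_zero_iff_left two_ne_zero, expand (A (e i) (e 0))] at h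
      simpa [hs, ← ha] using h)
    (by
      have h := PR2 (e i) (e 1) (e 1)
      rw [hsymm (e 1), ← two_mul, mul_eq_zero_iff_left two_ne_zero, expand (A (e i) (e 1))] at h
      simpa [← hb, ← hc] using h)
    (by
      have h := PR2 (e i) (e 0) (e 1)
      rw [expand (A (e i) (e 0)), expand (A (e i) (e 1))] at h
      simpa [← ha, ← hb, ← hc] using h)
  have key : ⁅e 0, e 1⁆ = 0 := by
    by_contra hz
    have trace (j : Fin 2) :
        e.repr (A (e 0) (e j)) 0 + e.repr (A (e 1) (e j)) 1 = 0 := by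
      have h := PR3 (e 0) (e j) (e 1)
      rw [expand (A (e 0) (e j)), expand (A (e 1) (e j))] at h
      simp only [add_lie, lie_add, smul_lie, lie_smul, lie_self, smul_zero, add_zero,
        zero_add, ← add_smul] at h
      exact (smul_eq_zero.1 h).resolve_right hz
    obtain ⟨t, hp, hq, hr, hs'⟩ := skew 0
    obtain ⟨t', hp', hq', hr', hs''⟩ := skew 1
    have h₀ := trace 0
    have h₁ := trace 1
    rw [hp, hq'] at h₀
    rw [hr, hs''] at h₁
    have ht : t = 0 := (mul_eq_zero.1 (show t * (a * c - b * b) = 0 by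
      linear_combination b * h₀ - a * h₁)).resolve_right hD
    have ht' : t' = 0 := (mul_eq_zero.1 (show t' * (a * c - b * b) = 0 by
      linear_combination c * h₀ - b * h₁)).resolve_right hD
    apply hz
    rw [← PR1, expand (A (e 0) (e 1)), expand (A (e 1) (e 0)), hr, hs', hp', hq', ht, ht']
    simp
  have key' : ⁅e 1, e 0⁆ = 0 := by rw [← lie_skew, key, neg_zero]
  intro u v
  rw [expand u, expand v]
  simp [key, key']
end

section
/- Let (g, B, A) be a pseudo-Riemannian Lie algebra over a field F of characteristic 0 with dim g = 3, such that g is non-abelian and the center of g is nontrivial. Then g is a Heisenberg Lie algebra: there exists a basis x, y, z of g with ⁅x, y⁆ = z, ⁅x, z⁆ = 0 and ⁅y, z⁆ = 0 (so z spans the center and ⁅g, g⁆ is contained in the center). -/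
/-- A skew-adjoint endomorphism for a nondegenerate symmetric bilinear form has trace zero. -/
theorem trace_eq_zero_of_skew {F V : Type*} [Field F] [CharZero F] [AddCommGroup V] [Module F V]
    [FiniteDimensional F V] (B : LinearMap.BilinForm F V)
    (hnd : ∀ u : V, (∀ v : V, B u v = 0) → u = 0)
    (f : V →ₗ[F] V) (hf : ∀ v w : V, B (f v) w + B v (f w) = 0) :
    LinearMap.trace F V f = 0 := by
  have hinj : Function.Injective B :=
    (injective_iff_map_eq_zero B).2 fun u hu => hnd u fun v => by rw [hu]; rfl
  let φ : V ≃ₗ[F] Module.Dual F V :=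
    LinearEquiv.ofInjectiveOfFinrankEq B hinj Subspace.dual_finrank_eq.symm
  have hconj : φ.conj f = -Module.Dual.transpose (R := F) f := by
    ext ψ w
    obtain ⟨v, rfl⟩ := φ.surjective ψ
    have h : B (f v) w = -B v (f w) := eq_neg_of_add_eq_zero_left (hf v w)
    rw [LinearEquiv.conj_apply_apply, φ.symm_apply_apply]
    exact h
  have htr := LinearMap.trace_conj' f φ
  have hneg : LinearMap.trace F (Module.Dual F V) (-Module.Dual.transpose (R := F) f) =
      -LinearMap.trace F V f := by
    rw [← LinearMap.trace_transpose' f]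
    exact map_neg (LinearMap.trace F (Module.Dual F V)) _
  exact self_eq_neg.1 (htr.symm.trans ((congrArg _ hconj).trans hneg))

/-- In a pseudo-Riemannian Lie algebra, left multiplication by a central element vanishes. -/
theorem pseudoRiemannian_central_mul_eq_zero {F g : Type*} [Field F] [CharZero F]
    [LieRing g] [LieAlgebra F g]
    (B : LinearMap.BilinForm F g) (hsymm : ∀ u v : g, B u v = B v u)
    (hnd : ∀ u : g, (∀ v : g, B u v = 0) → u = 0) (A : g →ₗ[F] g →ₗ[F] g)
    (PR2 : ∀ u v w : g, B (A u v) w + B v (A u w) = 0)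
    {a : g} (ha : a ≠ 0) (hA : ∀ v, ∃ c : F, A a v = c • a) (v : g) : A a v = 0 := by
  obtain ⟨c, hc⟩ := hA v
  by_contra hne
  have hc0 : c ≠ 0 := by rintro rfl; simp [hc] at hne
  have hv : B a v = 0 := by
    have h := PR2 a v v
    rw [hc, hsymm v] at h
    simpa [← two_mul, hc0] using h
  refine ha (hnd a fun w => ?_)
  obtain ⟨d, hd⟩ := hA w
  have h := PR2 a v w
  rw [hc, hd, hsymm v] at h
  simpa [hv, hc0] using h

/-- A three-dimensional pseudo-Riemannian Lie algebra is not the direct sum of a central line and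
the nonabelian two-dimensional Lie algebra. -/
theorem pseudoRiemannian_not_central_sum_affine {F g : Type*} [Field F] [CharZero F]
    [LieRing g] [LieAlgebra F g] [FiniteDimensional F g]
    (hdim : Module.finrank F g = 3)
    (B : LinearMap.BilinForm F g) (hsymm : ∀ u v : g, B u v = B v u)
    (hnd : ∀ u : g, (∀ v : g, B u v = 0) → u = 0) (A : g →ₗ[F] g →ₗ[F] g)
    (PR1 : ∀ u v : g, A u v - A v u = ⁅u, v⁆)
    (PR2 : ∀ u v w : g, B (A u v) w + B v (A u w) = 0)
    (PR3 : ∀ u v w : g, ⁅A u v, w⁆ + ⁅u, A w v⁆ = 0)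
    {a e z : g} (ha : a ≠ 0) (hac : ∀ x : g, ⁅a, x⁆ = 0) (hz : z ≠ 0) (hez : ⁅e, z⁆ = z) :
    False := by
  have hca : ∀ x : g, ⁅x, a⁆ = 0 := fun x => by rw [← lie_skew, hac, neg_zero]
  have hli : LinearIndependent F ![a, e, z] := by
    rw [Fintype.linearIndependent_iff]
    intro c hc
    simp only [Fin.sum_univ_three, Matrix.cons_val] at hc
    have h1 : c 1 = 0 := by
      have h := congrArg (⁅·, z⁆) hc
      simpa [hac, hez, hz] using h
    have h2 : c 2 = 0 := by
      have h := congrArg (⁅e, ·⁆) hc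
      simpa [hca, hez, hz] using h
    have h0 : c 0 = 0 := by simpa [h1, h2, ha] using hc
    intro i
    fin_cases i <;> assumption
  let b : Module.Basis (Fin 3) F g :=
    basisOfLinearIndependentOfCardEqFinrank hli (by simp [hdim])
  have hb0 : b 0 = a := by simp [b]
  have hb1 : b 1 = e := by simp [b]
  have hb2 : b 2 = z := by simp [b]
  have hexp : ∀ v, v = b.repr v 0 • a + b.repr v 1 • e + b.repr v 2 • z := fun v => by
    have h := b.sum_repr v
    rw [Fin.sum_univ_three, hb0, hb1, hb2] at h
    exact h.symm
  have hlie_z : ∀ v : g, ⁅v, z⁆ = b.repr v 1 • z := fun v => by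
    conv_lhs => rw [hexp v]
    simp [hac, hez]
  have hlie_e : ∀ v : g, ⁅e, v⁆ = b.repr v 2 • z := fun v => by
    conv_lhs => rw [hexp v]
    simp [hca, hez]
  have hAa : ∀ v, A a v = 0 := pseudoRiemannian_central_mul_eq_zero B hsymm hnd A PR2 ha fun v => by
    have h : ∀ w : g, ⁅A a v, w⁆ = 0 := fun w => by simpa [hac] using PR3 a v w
    have h1 : b.repr (A a v) 1 = 0 := by simpa [hz, hlie_z] using h z
    have h2 : b.repr (A a v) 2 = 0 := by
      have := h e
      rw [← lie_skew, hlie_e] at this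
      simpa [hz] using this
    exact ⟨b.repr (A a v) 0, by simpa [h1, h2] using hexp (A a v)⟩
  have hea : A e a = 0 := by simpa [hAa, hca] using PR1 e a
  have h3 : b.repr (A e e) 1 + b.repr (A z e) 2 = 0 := by
    have h := PR3 e e z
    rw [hlie_z, hlie_e, ← add_smul] at h
    exact (smul_eq_zero.1 h).resolve_right hz
  have h4 : b.repr (A e z) 2 = b.repr (A z e) 2 + 1 := by
    have h : A e z = A z e + z := by rw [← sub_eq_iff_eq_add', PR1, hez]
    rw [h, ← hb2]
    simp
  have htr := trace_eq_zero_of_skew B hnd (A e) (PR2 e)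
  rw [LinearMap.trace_eq_matrix_trace F b, Matrix.trace, Fin.sum_univ_three] at htr
  simp only [Matrix.diag_apply, LinearMap.toMatrix_apply, hb0, hb1, hb2, hea, h4] at htr
  rw [← add_assoc] at htr
  simp [h3] at htr

/-- A 3-dimensional non-abelian pseudo-Riemannian Lie algebra with nontrivial center
is a Heisenberg Lie algebra: it has a basis `x, y, z` with `⁅x,y⁆ = z`, `⁅x,z⁆ = 0`,
`⁅y,z⁆ = 0`. -/
theorem pseudoRiemannian_dim_three_center_heisenberg
    {F : Type*} [Field F] [CharZero F]
    {g : Type*} [LieRing g] [LieAlgebra F g] [FiniteDimensional F g]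
    (hdim : Module.finrank F g = 3)
    (hnab : ¬ ∀ u v : g, ⁅u, v⁆ = 0)
    (hcenter : ∃ a : g, a ≠ 0 ∧ ∀ x : g, ⁅a, x⁆ = 0)
    (B : LinearMap.BilinForm F g)
    (hsymm : ∀ u v : g, B u v = B v u)
    (hnd : ∀ u : g, (∀ v : g, B u v = 0) → u = 0)
    (A : g →ₗ[F] g →ₗ[F] g)
    (PR1 : ∀ u v : g, A u v - A v u = ⁅u, v⁆)
    (PR2 : ∀ u v w : g, B (A u v) w + B v (A u w) = 0)
    (PR3 : ∀ u v w : g, ⁅A u v, w⁆ + ⁅u, A w v⁆ = 0) :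
    ∃ x y z : g,
      LinearIndependent F ![x, y, z] ∧
      Submodule.span F {x, y, z} = ⊤ ∧
      ⁅x, y⁆ = z ∧ ⁅x, z⁆ = 0 ∧ ⁅y, z⁆ = 0 := by
  obtain ⟨a, ha, hac⟩ := hcenter
  push Not at hnab
  obtain ⟨x, y, hz⟩ := hnab
  have hca : ∀ x : g, ⁅x, a⁆ = 0 := fun x => by rw [← lie_skew, hac, neg_zero]
  have hyx : ⁅y, x⁆ = -⁅x, y⁆ := (lie_skew y x).symm
  obtain ⟨p, q, hp, hq⟩ : ∃ p q : F, ⁅x, ⁅x, y⁆⁆ = p • ⁅x, y⁆ ∧ ⁅y, ⁅x, y⁆⁆ = q • ⁅x, y⁆ := by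
    have hli : LinearIndependent F ![a, x, y] := by
      rw [Fintype.linearIndependent_iff]
      intro c hc
      simp only [Fin.sum_univ_three, Matrix.cons_val] at hc
      have h1 : c 1 = 0 := by
        have h := congrArg (⁅·, y⁆) hc
        simpa [hac, hz] using h
      have h2 : c 2 = 0 := by
        have h := congrArg (⁅x, ·⁆) hc
        simpa [hca, hz] using h
      have h0 : c 0 = 0 := by simpa [h1, h2, ha] using hc
      intro i
      fin_cases i <;> assumption
    let b : Module.Basis (Fin 3) F g :=
      basisOfLinearIndependentOfCardEqFinrank hli (by simp [hdim])
    have hexp : ∀ v, v = b.repr v 0 • a + b.repr v 1 • x + b.repr v 2 • y := fun v => by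
      conv_lhs => rw [← b.sum_repr v]
      simp [Fin.sum_univ_three, b]
    refine ⟨b.repr ⁅x, y⁆ 2, -b.repr ⁅x, y⁆ 1, ?_, ?_⟩
    · have h := congrArg (⁅x, ·⁆) (hexp ⁅x, y⁆)
      simpa only [lie_add, lie_smul, lie_self, hca, smul_zero, zero_add] using h
    · have h := congrArg (⁅y, ·⁆) (hexp ⁅x, y⁆)
      simpa only [lie_add, lie_smul, lie_self, hca, hyx, smul_zero, zero_add, add_zero, smul_neg,
        neg_smul] using h
  have hp0 : p = 0 := by
    by_contra h
    refine pseudoRiemannian_not_central_sum_affine hdim B hsymm hnd A PR1 PR2 PR3 ha hac hz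
      (e := p⁻¹ • x) ?_
    rw [smul_lie, hp, inv_smul_smul₀ h]
  have hq0 : q = 0 := by
    by_contra h
    refine pseudoRiemannian_not_central_sum_affine hdim B hsymm hnd A PR1 PR2 PR3 ha hac hz
      (e := q⁻¹ • y) ?_
    rw [smul_lie, hq, inv_smul_smul₀ h]
  rw [hp0, zero_smul] at hp
  rw [hq0, zero_smul] at hq
  have hli : LinearIndependent F ![x, y, ⁅x, y⁆] := by
    rw [Fintype.linearIndependent_iff]
    intro c hc
    simp only [Fin.sum_univ_three, Matrix.cons_val] at hc
    have h0 : c 0 = 0 := by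
      have h := congrArg (⁅y, ·⁆) hc
      simpa only [lie_add, lie_smul, lie_self, lie_zero, hyx, hq, smul_zero, add_zero, smul_neg,
        neg_eq_zero, smul_eq_zero, hz, or_false] using h
    have h1 : c 1 = 0 := by
      have h := congrArg (⁅x, ·⁆) hc
      simpa only [lie_add, lie_smul, lie_self, lie_zero, hp, smul_zero, add_zero, zero_add,
        smul_eq_zero, hz, or_false] using h
    have h2 : c 2 = 0 := by simpa [h0, h1, hz] using hc
    intro i
    fin_cases i <;> assumption
  refine ⟨x, y, ⁅x, y⁆, hli, ?_, rfl, hp, hq⟩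
  have hspan := hli.span_eq_top_of_card_eq_finrank (by simp [hdim])
  simpa only [Matrix.range_cons, Matrix.range_empty, Set.union_empty, Set.singleton_union]
    using hspan
end

section
/- Let (g, B, A) be a Riemann-Lie algebra (a real pseudo-Riemannian Lie algebra whose bilinear form B is positive definite) with dim g = 3. If the center of g is nontrivial, then g is abelian. Equivalently, a 3-dimensional non-abelian real Lie algebra with nontrivial center admits no Riemann-Lie algebra structure. -/
/-- In dimension three, three nonzero pairwise orthogonal vectors of a positive definite form
span the space. -/
theorem exists_eq_combination_of_orthogonal {V : Type*} [AddCommGroup V] [Module ℝ V]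
    (hdim : Module.finrank ℝ V = 3) (B : LinearMap.BilinForm ℝ V)
    (hsymm : ∀ u v : V, B u v = B v u) (hpos : ∀ u : V, u ≠ 0 → 0 < B u u)
    {z p q : V} (hz : z ≠ 0) (hp : p ≠ 0) (hq : q ≠ 0)
    (hzp : B z p = 0) (hzq : B z q = 0) (hpq : B p q = 0) (x : V) :
    ∃ a b c : ℝ, a • z + b • p + c • q = x := by
  have hpz : B p z = 0 := hsymm p z ▸ hzp
  have hqz : B q z = 0 := hsymm q z ▸ hzq
  have hqp : B q p = 0 := hsymm q p ▸ hpq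
  have hli : LinearIndependent ℝ ![z, p, q] := by
    rw [Fintype.linearIndependent_iff]
    intro c hc
    simp only [Fin.sum_univ_three, Matrix.cons_val] at hc
    have h0 := congrArg (B z) hc
    have h1 := congrArg (B p) hc
    have h2 := congrArg (B q) hc
    simp only [map_add, map_smul, smul_eq_mul, map_zero, hzp, hzq, hpq, hpz, hqz, hqp,
      mul_zero, add_zero, zero_add] at h0 h1 h2
    intro i
    fin_cases i
    · exact (mul_eq_zero.mp h0).resolve_right (hpos z hz).ne'
    · exact (mul_eq_zero.mp h1).resolve_right (hpos p hp).ne'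
    · exact (mul_eq_zero.mp h2).resolve_right (hpos q hq).ne'
  have htop := hli.span_eq_top_of_card_eq_finrank (by simp [hdim])
  have hx : x ∈ Submodule.span ℝ (Set.range ![z, p, q]) := htop ▸ Submodule.mem_top
  obtain ⟨c, hc⟩ := (Submodule.mem_span_range_iff_exists_fun ℝ).mp hx
  exact ⟨c 0, c 1, c 2, by simpa [Fin.sum_univ_three] using hc⟩

/-- In a 3-dimensional Riemann-Lie algebra, vectors that are orthogonal to each other and to a
nonzero central vector commute. -/
theorem lie_eq_zero_of_orthogonal_of_central
    {g : Type*} [LieRing g] [LieAlgebra ℝ g] (hdim : Module.finrank ℝ g = 3)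
    (B : LinearMap.BilinForm ℝ g)
    (hsymm : ∀ u v : g, B u v = B v u) (hpos : ∀ u : g, u ≠ 0 → 0 < B u u)
    (A : g →ₗ[ℝ] g →ₗ[ℝ] g)
    (PR1 : ∀ u v : g, A u v - A v u = ⁅u, v⁆)
    (PR2 : ∀ u v w : g, B (A u v) w + B v (A u w) = 0)
    (PR3 : ∀ u v w : g, ⁅A u v, w⁆ + ⁅u, A w v⁆ = 0)
    {z p q : g} (hz : z ≠ 0) (hcentral : ∀ x : g, ⁅z, x⁆ = 0)
    (hzp : B z p = 0) (hzq : B z q = 0) (hpq : B p q = 0) : ⁅p, q⁆ = 0 := by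
  by_contra hD
  have hD' : ⁅q, p⁆ ≠ 0 := fun h => hD (by rw [← lie_skew, h, neg_zero])
  have hp : p ≠ 0 := by rintro rfl; simp at hD
  have hq : q ≠ 0 := by rintro rfl; simp at hD
  have hpz : B p z = 0 := hsymm p z ▸ hzp
  have hqz : B q z = 0 := hsymm q z ▸ hzq
  have hqp : B q p = 0 := hsymm q p ▸ hpq
  have hspan := exists_eq_combination_of_orthogonal hdim B hsymm hpos hz hp hq hzp hzq hpq
  have hself : ∀ u v : g, B (A u v) v = 0 := fun u v => by
    have h := PR2 u v v
    rw [hsymm v] at h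
    linarith
  have hAzz : ∀ v, ∃ a : ℝ, a • z = A z v := by
    intro v
    have hcomm : ∀ w : g, ⁅A z v, w⁆ = 0 := fun w => by simpa [hcentral] using PR3 z v w
    obtain ⟨a, b, c, h⟩ := hspan (A z v)
    have h1 := hcomm p
    have h2 := hcomm q
    rw [← h] at h1 h2
    simp only [add_lie, smul_lie, hcentral, lie_self, smul_zero, zero_add, add_zero] at h1 h2
    have hc : c = 0 := by simpa [hD'] using h1
    have hb : b = 0 := by simpa [hD] using h2
    exact ⟨a, by simpa [hb, hc] using h⟩
  have hAz : ∀ v, A z v = 0 := by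
    have eq_zero_of : ∀ v, B (A z v) z = 0 → A z v = 0 := by
      intro v hv
      obtain ⟨a, ha⟩ := hAzz v
      rw [← ha] at hv ⊢
      have : a = 0 := by simpa [(hpos z hz).ne'] using hv
      simp [this]
    intro v
    apply eq_zero_of
    have h := PR2 z v z
    rwa [eq_zero_of z (hself z z), map_zero, add_zero] at h
  have hA : ∀ u, A u z = 0 := fun u => by simpa [hAz, hcentral] using PR1 z u
  have hAperp : ∀ u v, B (A u v) z = 0 := fun u v => by simpa [hA] using PR2 u v z
  have hAp : ∀ u, ∃ c : ℝ, c • q = A u p := by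
    intro u
    obtain ⟨a, b, c, h⟩ := hspan (A u p)
    have h1 := hAperp u p
    have h2 := hself u p
    rw [← h] at h1 h2
    have ha : a = 0 := by simpa [hpz, hqz, (hpos z hz).ne'] using h1
    have hb : b = 0 := by simpa [hzp, hqp, (hpos p hp).ne'] using h2
    exact ⟨c, by simpa [ha, hb] using h⟩
  have hAq : ∀ u, ∃ b : ℝ, b • p = A u q := by
    intro u
    obtain ⟨a, b, c, h⟩ := hspan (A u q)
    have h1 := hAperp u q
    have h2 := hself u q
    rw [← h] at h1 h2
    have ha : a = 0 := by simpa [hpz, hqz, (hpos z hz).ne'] using h1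
    have hc : c = 0 := by simpa [hzq, hpq, (hpos q hq).ne'] using h2
    exact ⟨b, by simpa [ha, hc] using h⟩
  have hAqp : A q p = 0 := by
    obtain ⟨a, ha⟩ := hAp p
    obtain ⟨b, hb⟩ := hAp q
    have h := PR3 p p q
    rw [← ha, ← hb] at h
    have : b = 0 := by simpa [hD] using h
    rw [← hb, this, zero_smul]
  have hApq : A p q = 0 := by
    obtain ⟨a, ha⟩ := hAq p
    obtain ⟨b, hb⟩ := hAq q
    have h := PR3 p q q
    rw [← ha, ← hb] at h
    have : a = 0 := by simpa [hD] using h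
    rw [← ha, this, zero_smul]
  exact hD (by rw [← PR1, hAqp, hApq, sub_zero])

/-- A 3-dimensional Riemann-Lie algebra with nontrivial center is abelian; equivalently,
no 3-dimensional non-abelian real Lie algebra with nontrivial center carries a
Riemann-Lie algebra structure. -/
theorem riemann_dim_three_center_abelian
    {g : Type*} [LieRing g] [LieAlgebra ℝ g] [FiniteDimensional ℝ g]
    (hdim : Module.finrank ℝ g = 3)
    (hcenter : ∃ a : g, a ≠ 0 ∧ ∀ x : g, ⁅a, x⁆ = 0)
    (B : LinearMap.BilinForm ℝ g)
    (hsymm : ∀ u v : g, B u v = B v u)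
    (hpos : ∀ u : g, u ≠ 0 → 0 < B u u)
    (A : g →ₗ[ℝ] g →ₗ[ℝ] g)
    (PR1 : ∀ u v : g, A u v - A v u = ⁅u, v⁆)
    (PR2 : ∀ u v w : g, B (A u v) w + B v (A u w) = 0)
    (PR3 : ∀ u v w : g, ⁅A u v, w⁆ + ⁅u, A w v⁆ = 0) :
    ∀ u v : g, ⁅u, v⁆ = 0 := by
  obtain ⟨z, hz, hcentral⟩ := hcenter
  have hcentral' : ∀ x : g, ⁅x, z⁆ = 0 := fun x => by rw [← lie_skew, hcentral, neg_zero]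
  have hproj : ∀ w v : g, w ≠ 0 → B w (v - (B w v / B w w) • w) = 0 := by
    intro w v hw
    have := (hpos w hw).ne'
    simp only [map_sub, map_smul, smul_eq_mul]
    field_simp
    ring
  intro u v
  set p := u - (B z u / B z z) • z with hp
  set r := v - (B z v / B z z) • z with hr
  have huv : ⁅u, v⁆ = ⁅p, r⁆ := by simp [hp, hr, hcentral, hcentral']
  have hzp : B z p = 0 := hproj z u hz
  have hzr : B z r = 0 := hproj z v hz
  rw [huv]
  by_cases hp0 : p = 0
  · simp [hp0]
  have hzq : B z (r - (B p r / B p p) • p) = 0 := by simp [hzp, hzr]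
  have h := lie_eq_zero_of_orthogonal_of_central hdim B hsymm hpos A PR1 PR2 PR3 hz hcentral
    hzp hzq (hproj p r hp0)
  simpa using h
end

section
/- Let (g, B, A) be a pseudo-Riemannian Lie algebra over a field F of characteristic 0 with dim g = 3 and trivial center (the only element commuting with all of g is 0). Then there exist a basis x, y, z of g and a nonzero scalar c ∈ F such that ⁅x, y⁆ = z, ⁅x, z⁆ = c·y and ⁅y, z⁆ = 0. -/
open Module

section Bracket

variable {F : Type*} [Field F] {g : Type*} [LieRing g] [LieAlgebra F g]

theorem Module.Basis.eq_sum_fin_three (b : Basis (Fin 3) F g) (v : g) :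
    v = b.repr v 0 • b 0 + b.repr v 1 • b 1 + b.repr v 2 • b 2 := by
  conv_lhs => rw [← b.sum_repr v, Fin.sum_univ_three]

theorem Module.Basis.linearIndependent_and_span_of_fin_two_det_ne_zero (b : Basis (Fin 3) F g)
    {n₁ n₂ m₁ m₂ : F} (h : n₁ * m₂ - n₂ * m₁ ≠ 0) :
    LinearIndependent F ![b 0, n₁ • b 1 + n₂ • b 2, m₁ • b 1 + m₂ • b 2] ∧
      Submodule.span F (Set.range ![b 0, n₁ • b 1 + n₂ • b 2, m₁ • b 1 + m₂ • b 2]) = ⊤ := by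
  rw [Basis.is_basis_iff_det b, Basis.det_apply, Matrix.det_fin_three, isUnit_iff_ne_zero]
  simpa [Basis.toMatrix_apply, Finsupp.single_apply, mul_comm m₁] using h

/-- A nontrivial relation between the brackets of basis vectors comes from a commuting pair, since
every bivector in dimension three is decomposable. -/
theorem exists_basis_lie_eq_zero_of_relation (b : Basis (Fin 3) F g) {p q r : F} (hr : r ≠ 0)
    (h : p • ⁅b 0, b 1⁆ + q • ⁅b 0, b 2⁆ + r • ⁅b 1, b 2⁆ = 0) :
    ∃ b' : Basis (Fin 3) F g, ⁅b' 1, b' 2⁆ = 0 := by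
  have hb : LinearIndependent F ![b 0, b 1 + (q / r) • b 0, b 2 + (-p / r) • b 0] ∧
      Submodule.span F (Set.range ![b 0, b 1 + (q / r) • b 0, b 2 + (-p / r) • b 0]) = ⊤ := by
    rw [Basis.is_basis_iff_det b, Basis.det_apply, Matrix.det_fin_three, isUnit_iff_ne_zero]
    simp [Basis.toMatrix_apply]
  refine ⟨Basis.mk hb.1 hb.2.ge, ?_⟩
  have h' : ⁅b 1 + (q / r) • b 0, b 2 + (-p / r) • b 0⁆ =
      r⁻¹ • (p • ⁅b 0, b 1⁆ + q • ⁅b 0, b 2⁆ + r • ⁅b 1, b 2⁆) := by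
    simp only [add_lie, lie_add, smul_lie, lie_smul, lie_self]
    rw [← lie_skew (b 0) (b 1)]
    match_scalars <;> field_simp
  simp [h', h]

theorem lie_basis_relation_trivial (hne : ∀ b : Basis (Fin 3) F g, ⁅b 1, b 2⁆ ≠ 0)
    (b : Basis (Fin 3) F g) {p q r : F}
    (h : p • ⁅b 0, b 1⁆ + q • ⁅b 0, b 2⁆ + r • ⁅b 1, b 2⁆ = 0) : p = 0 ∧ q = 0 ∧ r = 0 := by
  have key : ∀ (b : Basis (Fin 3) F g) (p q r : F),
      p • ⁅b 0, b 1⁆ + q • ⁅b 0, b 2⁆ + r • ⁅b 1, b 2⁆ = 0 → r = 0 := by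
    intro b p q r h
    by_contra hr
    obtain ⟨b', hb'⟩ := exists_basis_lie_eq_zero_of_relation b hr h
    exact hne b' hb'
  refine ⟨?_, ?_, key b p q r h⟩
  · refine neg_eq_zero.mp (key (b.reindex (Equiv.swap 0 2)) (-r) (-q) (-p) ?_)
    have h1 : Equiv.swap (0 : Fin 3) 2 1 = 1 := by decide
    simp only [Basis.reindex_apply, Equiv.symm_swap, Equiv.swap_apply_left,
      Equiv.swap_apply_right, h1]
    rw [← h, ← lie_skew (b 0) (b 1), ← lie_skew (b 0) (b 2), ← lie_skew (b 1) (b 2)]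
    module
  · refine key (b.reindex (Equiv.swap 0 1)) (-p) r q ?_
    have h2 : Equiv.swap (0 : Fin 3) 1 2 = 2 := by decide
    simp only [Basis.reindex_apply, Equiv.symm_swap, Equiv.swap_apply_left,
      Equiv.swap_apply_right, h2]
    rw [← h, ← lie_skew (b 0) (b 1)]
    module

theorem lie_relation_zero_one {R : g →ₗ[F] g} (hR : ∀ u w : g, ⁅R u, w⁆ + ⁅u, R w⁆ = 0)
    (b : Basis (Fin 3) F g) :
    (b.repr (R (b 0)) 0 + b.repr (R (b 1)) 1) • ⁅b 0, b 1⁆ + b.repr (R (b 1)) 2 • ⁅b 0, b 2⁆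
      + (-b.repr (R (b 0)) 2) • ⁅b 1, b 2⁆ = 0 := by
  rw [← hR (b 0) (b 1)]
  conv_rhs => rw [b.eq_sum_fin_three (R (b 0)), b.eq_sum_fin_three (R (b 1))]
  simp only [add_lie, lie_add, smul_lie, lie_smul, lie_self]
  rw [← lie_skew (b 2) (b 1)]
  module

theorem lie_relation_zero_two {R : g →ₗ[F] g} (hR : ∀ u w : g, ⁅R u, w⁆ + ⁅u, R w⁆ = 0)
    (b : Basis (Fin 3) F g) :
    b.repr (R (b 2)) 1 • ⁅b 0, b 1⁆ + (b.repr (R (b 0)) 0 + b.repr (R (b 2)) 2) • ⁅b 0, b 2⁆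
      + b.repr (R (b 0)) 1 • ⁅b 1, b 2⁆ = 0 := by
  rw [← hR (b 0) (b 2)]
  conv_rhs => rw [b.eq_sum_fin_three (R (b 0)), b.eq_sum_fin_three (R (b 2))]
  simp only [add_lie, lie_add, smul_lie, lie_smul, lie_self]
  module

theorem lie_relation_one_two {R : g →ₗ[F] g} (hR : ∀ u w : g, ⁅R u, w⁆ + ⁅u, R w⁆ = 0)
    (b : Basis (Fin 3) F g) :
    (-b.repr (R (b 2)) 0) • ⁅b 0, b 1⁆ + b.repr (R (b 1)) 0 • ⁅b 0, b 2⁆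
      + (b.repr (R (b 1)) 1 + b.repr (R (b 2)) 2) • ⁅b 1, b 2⁆ = 0 := by
  rw [← hR (b 1) (b 2)]
  conv_rhs => rw [b.eq_sum_fin_three (R (b 1)), b.eq_sum_fin_three (R (b 2))]
  simp only [add_lie, lie_add, smul_lie, lie_smul, lie_self]
  rw [← lie_skew (b 0) (b 1)]
  module

theorem eq_zero_of_lie_relation_trivial [CharZero F] {R : g →ₗ[F] g} (hR : ∀ u w : g, ⁅R u, w⁆ + ⁅u, R w⁆ = 0)
    (b : Basis (Fin 3) F g)
    (hne : ∀ b : Basis (Fin 3) F g, ⁅b 1, b 2⁆ ≠ 0) : R = 0 := by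
  obtain ⟨h1, h2, h3⟩ := lie_basis_relation_trivial hne b (lie_relation_zero_one hR b)
  obtain ⟨h4, h5, h6⟩ := lie_basis_relation_trivial hne b (lie_relation_zero_two hR b)
  obtain ⟨h7, h8, h9⟩ := lie_basis_relation_trivial hne b (lie_relation_one_two hR b)
  have h00 : b.repr (R (b 0)) 0 = 0 := by linear_combination (h1 + h5 - h9) / 2
  have h11 : b.repr (R (b 1)) 1 = 0 := by linear_combination h1 - h00
  have h22 : b.repr (R (b 2)) 2 = 0 := by linear_combination h5 - h00
  rw [neg_eq_zero] at h3 h7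
  refine b.ext fun i => ?_
  rw [b.eq_sum_fin_three (R (b i))]
  fin_cases i <;> simp [*]

theorem eq_zero_of_smul_lie_add_smul_lie_eq_zero (b : Basis (Fin 3) F g)
    (hcenter : ∀ a : g, (∀ x : g, ⁅a, x⁆ = 0) → a = 0) (hb : ⁅b 1, b 2⁆ = 0) {p q : F}
    (h : p • ⁅b 0, b 1⁆ + q • ⁅b 0, b 2⁆ = 0) : p = 0 ∧ q = 0 := by
  have hb' : ⁅b 2, b 1⁆ = 0 := by rw [← lie_skew, hb, neg_zero]
  have h0 : p • b 1 + q • b 2 = 0 := by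
    refine hcenter _ fun x => ?_
    rw [b.eq_sum_fin_three x]
    simp only [add_lie, lie_add, smul_lie, lie_smul, lie_self, hb, hb']
    rw [← lie_skew (b 1) (b 0), ← lie_skew (b 2) (b 0)]
    linear_combination (norm := module) (-(b.repr x 0)) • h
  have h1 := congrArg (fun v => b.repr v 1) h0
  have h2 := congrArg (fun v => b.repr v 2) h0
  exact ⟨by simpa using h1, by simpa using h2⟩

/-- If `ad (b 0)` is traceless and invertible on the abelian plane spanned by `b 1` and `b 2`, then
it has a cyclic vector `y` there, and its square is a nonzero scalar. -/
theorem exists_normal_form_of_traceless [CharZero F] (b : Basis (Fin 3) F g)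
    (hb : ⁅b 1, b 2⁆ = 0) {p q r : F}
    (h1 : ⁅b 0, b 1⁆ = p • b 1 + q • b 2) (h2 : ⁅b 0, b 2⁆ = r • b 1 + (-p) • b 2)
    (hc : p ^ 2 + q * r ≠ 0) :
    ∃ (x y z : g) (c : F), c ≠ 0 ∧ LinearIndependent F ![x, y, z] ∧
      Submodule.span F {x, y, z} = ⊤ ∧ ⁅x, y⁆ = z ∧ ⁅x, z⁆ = c • y ∧ ⁅y, z⁆ = 0 := by
  have hb' : ⁅b 2, b 1⁆ = 0 := by rw [← lie_skew, hb, neg_zero]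
  obtain ⟨m, n, hmn⟩ : ∃ m n : F, m * (m * q - n * p) - n * (m * p + n * r) ≠ 0 := by
    by_cases hq : q = 0
    · by_cases hr : r = 0
      · refine ⟨1, 1, ?_⟩
        have hp : p ≠ 0 := by rintro rfl; simp [hq] at hc
        intro h
        apply hp
        linear_combination (-h + hq - hr) / 2
      · exact ⟨0, 1, by simpa using hr⟩
    · exact ⟨1, 0, by simpa using hq⟩
  obtain ⟨hli, hsp⟩ := b.linearIndependent_and_span_of_fin_two_det_ne_zero hmn
  refine ⟨b 0, m • b 1 + n • b 2, (m * p + n * r) • b 1 + (m * q - n * p) • b 2, p ^ 2 + q * r, hc,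
    hli, ?_, ?_, ?_, ?_⟩
  · rw [← hsp]
    congr 1
    rw [Matrix.range_cons, Matrix.range_cons_cons_empty, Set.singleton_union]
  · simp only [lie_add, lie_smul, h1, h2]
    module
  · simp only [lie_add, lie_smul, h1, h2]
    module
  · simp [hb, hb']

end Bracket

/-- A 3-dimensional centerless pseudo-Riemannian Lie algebra has a basis `x, y, z`
with `⁅x,y⁆ = z`, `⁅x,z⁆ = c•y` for some nonzero scalar `c`, and `⁅y,z⁆ = 0`. -/
theorem pseudoRiemannian_dim_three_centerless_structure
    {F : Type*} [Field F] [CharZero F]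
    {g : Type*} [LieRing g] [LieAlgebra F g] [FiniteDimensional F g]
    (hdim : Module.finrank F g = 3)
    (hcenter : ∀ a : g, (∀ x : g, ⁅a, x⁆ = 0) → a = 0)
    (B : LinearMap.BilinForm F g)
    (hsymm : ∀ u v : g, B u v = B v u)
    (hnd : ∀ u : g, (∀ v : g, B u v = 0) → u = 0)
    (A : g →ₗ[F] g →ₗ[F] g)
    (PR1 : ∀ u v : g, A u v - A v u = ⁅u, v⁆)
    (PR2 : ∀ u v w : g, B (A u v) w + B v (A u w) = 0)
    (PR3 : ∀ u v w : g, ⁅A u v, w⁆ + ⁅u, A w v⁆ = 0) :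
    ∃ (x y z : g) (c : F),
      c ≠ 0 ∧
      LinearIndependent F ![x, y, z] ∧
      Submodule.span F {x, y, z} = ⊤ ∧
      ⁅x, y⁆ = z ∧ ⁅x, z⁆ = c • y ∧ ⁅y, z⁆ = 0 := by
  have hRv : ∀ v u w : g, ⁅A.flip v u, w⁆ + ⁅u, A.flip v w⁆ = 0 := fun v u w => PR3 u v w
  obtain ⟨b, hb⟩ : ∃ b : Basis (Fin 3) F g, ⁅b 1, b 2⁆ = 0 := by
    by_contra! hne
    let b := finBasisOfFinrankEq F g hdim
    have hA : ∀ u v, A u v = 0 := fun u v =>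
      LinearMap.congr_fun (eq_zero_of_lie_relation_trivial (hRv v) b hne) u
    exact hne b (by rw [← PR1, hA, hA, sub_zero])
  have hind : ∀ p q : F, p • ⁅b 0, b 1⁆ + q • ⁅b 0, b 2⁆ = 0 → p = 0 ∧ q = 0 := fun p q =>
    eq_zero_of_smul_lie_add_smul_lie_eq_zero b hcenter hb
  have hrel : ∀ {p q r : F}, p • ⁅b 0, b 1⁆ + q • ⁅b 0, b 2⁆ + r • ⁅b 1, b 2⁆ = 0 →
      p = 0 ∧ q = 0 := fun {p q r} h => hind p q (by simpa [hb] using h)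
  have hA1 : ∀ v, A (b 1) v = (-b.repr (A (b 0) v) 0) • b 1 := by
    intro v
    obtain ⟨h1, h2⟩ := hrel (lie_relation_zero_one (hRv v) b)
    obtain ⟨-, h3⟩ := hrel (lie_relation_one_two (hRv v) b)
    conv_lhs => rw [b.eq_sum_fin_three (A (b 1) v)]
    rw [LinearMap.flip_apply] at h2 h3
    rw [LinearMap.flip_apply, LinearMap.flip_apply] at h1
    rw [h2, h3, eq_neg_of_add_eq_zero_right h1]
    simp
  have hA2 : ∀ v, A (b 2) v = (-b.repr (A (b 0) v) 0) • b 2 := by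
    intro v
    obtain ⟨h1, h2⟩ := hrel (lie_relation_zero_two (hRv v) b)
    obtain ⟨h3, -⟩ := hrel (lie_relation_one_two (hRv v) b)
    conv_lhs => rw [b.eq_sum_fin_three (A (b 2) v)]
    rw [LinearMap.flip_apply] at h1 h3
    rw [LinearMap.flip_apply, LinearMap.flip_apply] at h2
    rw [h1, neg_eq_zero.mp h3, eq_neg_of_add_eq_zero_right h2]
    simp
  have hsub : (-b.repr (A (b 0) (b 2)) 0) • b 1 - (-b.repr (A (b 0) (b 1)) 0) • b 2 = 0 := by
    rw [← hA1, ← hA2, PR1, hb]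
  have ha2 : b.repr (A (b 0) (b 2)) 0 = 0 := by
    simpa [Finsupp.single_apply] using congrArg (fun v => b.repr v 1) hsub
  have ha1 : b.repr (A (b 0) (b 1)) 0 = 0 := by
    simpa [Finsupp.single_apply] using congrArg (fun v => b.repr v 2) hsub
  have hB : ∀ u, B u (b 0) = 0 → B u (b 1) = 0 → B u (b 2) = 0 → u = 0 := by
    intro u h0 h1 h2
    refine hnd u fun v => ?_
    rw [b.eq_sum_fin_three v]
    simp [h0, h1, h2]
  have ha0 : b.repr (A (b 0) (b 0)) 0 = 0 := by
    by_contra hα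
    refine b.ne_zero 1 (hB _ ?_ ?_ ?_)
    · have := PR2 (b 1) (b 0) (b 0)
      rw [hsymm (b 0), hA1] at this
      simpa [hα] using this
    · have := PR2 (b 1) (b 0) (b 1)
      rw [hA1, hA1, ha1] at this
      simpa [hα] using this
    · have := PR2 (b 1) (b 0) (b 2)
      rw [hA1, hA1, ha2] at this
      simpa [hα] using this
  have hx0 := b.eq_sum_fin_three (A (b 0) (b 0))
  have hx1 := b.eq_sum_fin_three (A (b 0) (b 1))
  have hx2 := b.eq_sum_fin_three (A (b 0) (b 2))
  rw [ha0, zero_smul, zero_add] at hx0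
  rw [ha1, zero_smul, zero_add] at hx1
  rw [ha2, zero_smul, zero_add] at hx2
  have hl1 : ⁅b 0, b 1⁆ = A (b 0) (b 1) := by rw [← PR1, hA1, ha0]; simp
  have hl2 : ⁅b 0, b 2⁆ = A (b 0) (b 2) := by rw [← PR1, hA2, ha0]; simp
  generalize b.repr (A (b 0) (b 0)) 1 = k at hx0
  generalize b.repr (A (b 0) (b 0)) 2 = l at hx0
  generalize b.repr (A (b 0) (b 1)) 1 = p at hx1
  generalize b.repr (A (b 0) (b 1)) 2 = q at hx1
  generalize b.repr (A (b 0) (b 2)) 1 = r at hx2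
  generalize b.repr (A (b 0) (b 2)) 2 = s at hx2
  have e11 := PR2 (b 0) (b 1) (b 1)
  have e12 := PR2 (b 0) (b 1) (b 2)
  have e22 := PR2 (b 0) (b 2) (b 2)
  have e10 := PR2 (b 0) (b 1) (b 0)
  have e20 := PR2 (b 0) (b 2) (b 0)
  rw [hx1] at hl1
  rw [hx2] at hl2
  simp only [hx0, hx1, hx2, map_add, map_smul, LinearMap.add_apply, LinearMap.smul_apply,
    smul_eq_mul, hsymm (b 2) (b 1)] at e11 e12 e22 e10 e20
  have hgram : B (b 1) (b 1) * B (b 2) (b 2) - B (b 1) (b 2) ^ 2 ≠ 0 := by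
    intro hG
    have hrad : ∀ m n : F, m * B (b 1) (b 1) + n * B (b 1) (b 2) = 0 →
        m * B (b 1) (b 2) + n * B (b 2) (b 2) = 0 → m = 0 ∧ n = 0 := by
      intro m n h1 h2
      refine hind m n (hB _ ?_ ?_ ?_)
      all_goals
        simp only [hl1, hl2, map_add, map_smul, LinearMap.add_apply, LinearMap.smul_apply,
          smul_eq_mul, hsymm (b 2) (b 1)]
      · linear_combination m * e10 + n * e20 - k * h1 - l * h2
      · linear_combination m * e11 / 2 + n * e12 - p * h1 - q * h2 + m * e11 / 2
      · linear_combination m * e12 + n * e22 - r * h1 - s * h2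
    obtain ⟨h1, h2⟩ := hrad (B (b 1) (b 2)) (-B (b 1) (b 1)) (by ring) (by linear_combination -hG)
    exact one_ne_zero (hrad 1 0 (by linear_combination -h2) (by linear_combination h1)).1
  have hs : s = -p := by
    have : (p + s) * (B (b 1) (b 1) * B (b 2) (b 2) - B (b 1) (b 2) ^ 2) = 0 := by
      linear_combination B (b 2) (b 2) * e11 / 2 + B (b 1) (b 1) * e22 / 2 - B (b 1) (b 2) * e12
    exact eq_neg_of_add_eq_zero_right ((mul_eq_zero.mp this).resolve_right hgram)
  subst hs
  refine exists_normal_form_of_traceless b hb hl1 hl2 fun hdet => ?_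
  obtain ⟨h1, h2⟩ := hind p q (by
    rw [hl1, hl2]
    linear_combination (norm := module) hdet • b 1)
  obtain ⟨h3, -⟩ := hind r p (by
    rw [hl1, hl2, h1, h2]
    simp)
  have := hind 1 0 (by rw [hl1, h1, h2]; simp)
  exact one_ne_zero this.1
end

section
/- Let F be a field of characteristic 0 and let g be a 3-dimensional Lie algebra over F admitting a basis x, y, z and a nonzero scalar c ∈ F with ⁅x, y⁆ = z, ⁅x, z⁆ = c·y and ⁅y, z⁆ = 0. Then g admits a pseudo-Riemannian Lie algebra structure: there exist a nondegenerate symmetric bilinear form B on g and a bilinear product A : g × g → g satisfying (PR1), (PR2), (PR3); explicitly, one may take A x y = ⁅x, y⁆, A x z = ⁅x, z⁆, all other products of basis vectors zero, and B determined by B(x,x) = a, B(y,y) = b, B(z,z) = −b·c for any nonzero a, b ∈ F, with the basis vectors pairwise B-orthogonal. Moreover, if F = ℝ and c < 0, then B can be chosen positive definite, so that g is a Riemann-Lie algebra. -/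
section CoordinateConstruction

variable {F : Type*} [Field F] {g : Type*}

/-- The coordinate functionals of a basis `x, y, z`. -/
theorem exists_coordinates_of_basis [AddCommGroup g] [Module F g] {x y z : g}
    (hindep : LinearIndependent F ![x, y, z])
    (hspan : Submodule.span F {x, y, z} = ⊤) :
    ∃ p q r : g →ₗ[F] F, (∀ u, u = p u • x + q u • y + r u • z) ∧
      (p x = 1 ∧ p y = 0 ∧ p z = 0) ∧ (q x = 0 ∧ q y = 1 ∧ q z = 0) ∧
      (r x = 0 ∧ r y = 0 ∧ r z = 1) := by
  have hrange : Set.range ![x, y, z] = {x, y, z} := by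
    simp only [Matrix.range_cons, Matrix.range_empty, Set.union_empty, Set.singleton_union]
  let e := Module.Basis.mk hindep (by rw [hrange, hspan])
  have hx : e 0 = x := by simp [e]
  have hy : e 1 = y := by simp [e]
  have hz : e 2 = z := by simp [e]
  refine ⟨e.coord 0, e.coord 1, e.coord 2, fun u => ?_, ?_⟩
  · have h := e.sum_repr u
    rw [Fin.sum_univ_three, hx, hy, hz] at h
    exact h.symm
  · rw [← hx, ← hy, ← hz]
    simp [Module.Basis.coord_apply]

/-- The bilinear form `α p ⊗ p + β q ⊗ q + γ r ⊗ r`. -/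
def diagonalForm [AddCommGroup g] [Module F g] (p q r : g →ₗ[F] F) (α β γ : F) :
    LinearMap.BilinForm F g :=
  α • p.smulRight p + β • q.smulRight q + γ • r.smulRight r

theorem diagonalForm_apply [AddCommGroup g] [Module F g] (p q r : g →ₗ[F] F) (α β γ : F)
    (u v : g) :
    diagonalForm p q r α β γ u v =
      α * (p u * p v) + β * (q u * q v) + γ * (r u * r v) := by
  simp [diagonalForm]

theorem diagonalForm_comm [AddCommGroup g] [Module F g] (p q r : g →ₗ[F] F) (α β γ : F)
    (u v : g) : diagonalForm p q r α β γ u v = diagonalForm p q r α β γ v u := by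
  simp only [diagonalForm_apply]
  ring

variable [LieRing g] [LieAlgebra F g]

/-- The product `A u v = p u • ⁅x, v⁆`. -/
def coordinateProduct (p : g →ₗ[F] F) (x : g) : g →ₗ[F] g →ₗ[F] g :=
  p.smulRight (LieAlgebra.ad F g x : g →ₗ[F] g)

theorem coordinateProduct_apply (p : g →ₗ[F] F) (x u v : g) :
    coordinateProduct p x u v = p u • ⁅x, v⁆ := by
  simp [coordinateProduct]

variable {x y z : g} {c : F} {p q r : g →ₗ[F] F}

theorem lie_eq_of_coordinates (hu : ∀ u, u = p u • x + q u • y + r u • z)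
    (hxy : ⁅x, y⁆ = z) (hxz : ⁅x, z⁆ = c • y) (hyz : ⁅y, z⁆ = 0) (u v : g) :
    ⁅u, v⁆ = (c * (p u * r v - p v * r u)) • y + (p u * q v - p v * q u) • z := by
  have hyx : ⁅y, x⁆ = -z := by rw [← lie_skew, hxy]
  have hzx : ⁅z, x⁆ = -(c • y) := by rw [← lie_skew, hxz]
  have hzy : ⁅z, y⁆ = 0 := by rw [← lie_skew, hyz, neg_zero]
  conv_lhs => rw [hu u, hu v]
  simp only [add_lie, lie_add, smul_lie, lie_smul, lie_self, hxy, hxz, hyz, hyx, hzx, hzy]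
  module

theorem coordinateProduct_pseudoRiemannian (hu : ∀ u, u = p u • x + q u • y + r u • z)
    (hp : p x = 1 ∧ p y = 0 ∧ p z = 0) (hq : q x = 0 ∧ q y = 1 ∧ q z = 0)
    (hr : r x = 0 ∧ r y = 0 ∧ r z = 1)
    (hxy : ⁅x, y⁆ = z) (hxz : ⁅x, z⁆ = c • y) (hyz : ⁅y, z⁆ = 0) (a b : F) :
    (∀ u v, coordinateProduct p x u v - coordinateProduct p x v u = ⁅u, v⁆) ∧
    (∀ u v w, diagonalForm p q r a b (-(b * c)) (coordinateProduct p x u v) w +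
      diagonalForm p q r a b (-(b * c)) v (coordinateProduct p x u w) = 0) ∧
    (∀ u v w, ⁅coordinateProduct p x u v, w⁆ + ⁅u, coordinateProduct p x w v⁆ = 0) := by
  obtain ⟨hpx, hpy, hpz⟩ := hp
  obtain ⟨hqx, hqy, hqz⟩ := hq
  obtain ⟨hrx, hry, hrz⟩ := hr
  have hlie := lie_eq_of_coordinates hu hxy hxz hyz
  refine ⟨fun u v => ?_, fun u v w => ?_, fun u v w => ?_⟩
  · rw [coordinateProduct_apply, coordinateProduct_apply, hlie x, hlie x, hlie u, hpx, hqx, hrx]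
    module
  · rw [diagonalForm_apply, diagonalForm_apply]
    simp only [coordinateProduct_apply, hlie, map_smul, map_add,
      smul_eq_mul, hpx, hpy, hpz, hqx, hqy, hqz, hrx, hry, hrz]
    ring
  · simp only [coordinateProduct_apply, hlie, map_smul, map_add,
      smul_eq_mul, hpx, hpy, hpz, hqx, hqy, hqz, hrx, hry, hrz]
    module

end CoordinateConstruction

/-- A 3-dimensional Lie algebra with basis `x, y, z` satisfying `⁅x,y⁆ = z`,
`⁅x,z⁆ = c•y` (`c ≠ 0`), `⁅y,z⁆ = 0` carries a pseudo-Riemannian Lie algebra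
structure, with the explicit product and bilinear form described in the paper;
moreover over `ℝ` with `c < 0` the form can be chosen positive definite, so such an
algebra is a Riemann-Lie algebra. -/
theorem dim_three_centerless_admits_pseudoRiemannian_structure
    {F : Type*} [Field F] [CharZero F]
    {g : Type*} [LieRing g] [LieAlgebra F g]
    (x y z : g) (c : F) (hc : c ≠ 0)
    (hindep : LinearIndependent F ![x, y, z])
    (hspan : Submodule.span F {x, y, z} = ⊤)
    (hxy : ⁅x, y⁆ = z) (hxz : ⁅x, z⁆ = c • y) (hyz : ⁅y, z⁆ = (0 : g))
    (a b : F) (ha : a ≠ 0) (hb : b ≠ 0) :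
    (∃ (B : LinearMap.BilinForm F g) (A : g →ₗ[F] g →ₗ[F] g),
      (∀ u v : g, B u v = B v u) ∧
      (∀ u : g, (∀ v : g, B u v = 0) → u = 0) ∧
      (∀ u v : g, A u v - A v u = ⁅u, v⁆) ∧
      (∀ u v w : g, B (A u v) w + B v (A u w) = 0) ∧
      (∀ u v w : g, ⁅A u v, w⁆ + ⁅u, A w v⁆ = 0) ∧
      A x y = ⁅x, y⁆ ∧ A x z = ⁅x, z⁆ ∧
      A x x = 0 ∧ A y x = 0 ∧ A y y = 0 ∧ A y z = 0 ∧
      A z x = 0 ∧ A z y = 0 ∧ A z z = 0 ∧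
      B x x = a ∧ B y y = b ∧ B z z = -(b * c) ∧
      B x y = 0 ∧ B x z = 0 ∧ B y z = 0) ∧
    (∀ (h : Type) [LieRing h] [LieAlgebra ℝ h],
      ∀ (x' y' z' : h) (c' : ℝ), c' < 0 →
        LinearIndependent ℝ ![x', y', z'] →
        Submodule.span ℝ {x', y', z'} = ⊤ →
        ⁅x', y'⁆ = z' → ⁅x', z'⁆ = c' • y' → ⁅y', z'⁆ = (0 : h) →
        ∃ (B : LinearMap.BilinForm ℝ h) (A : h →ₗ[ℝ] h →ₗ[ℝ] h),
          (∀ u v : h, B u v = B v u) ∧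
          (∀ u : h, u ≠ 0 → 0 < B u u) ∧
          (∀ u v : h, A u v - A v u = ⁅u, v⁆) ∧
          (∀ u v w : h, B (A u v) w + B v (A u w) = 0) ∧
          (∀ u v w : h, ⁅A u v, w⁆ + ⁅u, A w v⁆ = 0)) := by
  constructor
  · obtain ⟨p, q, r, hu, hp, hq, hr⟩ := exists_coordinates_of_basis hindep hspan
    obtain ⟨h₁, h₂, h₃⟩ := coordinateProduct_pseudoRiemannian hu hp hq hr hxy hxz hyz a b
    obtain ⟨hpx, hpy, hpz⟩ := hp
    obtain ⟨hqx, hqy, hqz⟩ := hq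
    obtain ⟨hrx, hry, hrz⟩ := hr
    refine ⟨diagonalForm p q r a b (-(b * c)), coordinateProduct p x,
      diagonalForm_comm p q r _ _ _, fun u h => ?_, h₁, h₂, h₃, ?_⟩
    · have hx := h x
      have hy := h y
      have hz := h z
      simp only [diagonalForm_apply, hpx, hpy, hpz, hqx, hqy, hqz, hrx, hry, hrz] at hx hy hz
      have hpu : p u = 0 := by simpa [ha] using hx
      have hqu : q u = 0 := by simpa [hb] using hy
      have hru : r u = 0 := by simpa [hb, hc] using hz
      rw [hu u, hpu, hqu, hru]
      simp
    · simp [coordinateProduct_apply, diagonalForm_apply, hpx, hpy, hpz, hqx, hqy, hqz,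
        hrx, hry, hrz]
  · intro h _ _ x' y' z' c' hc' hindep' hspan' hxy' hxz' hyz'
    obtain ⟨p, q, r, hu, hp, hq, hr⟩ := exists_coordinates_of_basis hindep' hspan'
    refine ⟨diagonalForm p q r 1 1 (-(1 * c')), coordinateProduct p x',
      diagonalForm_comm p q r _ _ _, fun u hne => ?_,
      coordinateProduct_pseudoRiemannian hu hp hq hr hxy' hxz' hyz' 1 1⟩
    rw [diagonalForm_apply]
    have hd : 0 < -(1 * c') := by linarith
    have hpp := mul_self_nonneg (p u)
    have hqq := mul_self_nonneg (q u)
    have hrr := mul_nonneg hd.le (mul_self_nonneg (r u))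
    by_contra! hle
    have hpu : p u = 0 := mul_self_eq_zero.mp (by linarith)
    have hqu : q u = 0 := mul_self_eq_zero.mp (by linarith)
    have hru : r u = 0 := by
      have h0 : -(1 * c') * (r u * r u) = 0 := by linarith
      exact mul_self_eq_zero.mp ((mul_eq_zero.mp h0).resolve_left hd.ne')
    apply hne
    rw [hu u, hpu, hqu, hru]
    simp
end
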